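/- arXiv:gr-qc/0006035 — 2 statements merged into one kernel-verified Lean document; each statement's English description precedes it below -/
import Mathlib

section
/- Let 2/3 < γ < 2 and let x be a Bianchi type IX solution of the Wainwright–Hsu system of Taub type with Σ₋ ≡ 0 and N₂ ≡ N₃ (all Nᵢ > 0). Then exactly one of the following holds: x converges to the fixed point F as τ → −∞; x converges to the fixed point P₁⁺(II) as τ → −∞; or lim_{τ→−∞} (Ω, Σ₊, Σ₋, N₁, N₂, N₃)(τ) = (0, −1, 0, 0, n₂, n₂) for some real number n₂ with 0 < n₂ < ∞. -/
open Real Filter Topology Set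

noncomputable section

namespace WainwrightHsu

/-- The deceleration parameter `q` of the Wainwright–Hsu system. -/
def qf (γ O Sp Sm : ℝ) : ℝ := (1/2) * (3*γ - 2) * O + 2 * (Sp^2 + Sm^2)

/-- The curvature term `S₊`. -/
def SPf (n1 n2 n3 : ℝ) : ℝ := (1/2) * ((n2 - n3)^2 - n1 * (2*n1 - n2 - n3))

/-- The curvature term `S₋`. -/
def SMf (n1 n2 n3 : ℝ) : ℝ := (Real.sqrt 3 / 2) * (n3 - n2) * (n1 - n2 - n3)

/-- The Hamiltonian constraint. -/
def Constraint (O Sp Sm n1 n2 n3 : ℝ) : Prop :=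
  O + Sp^2 + Sm^2 + (3/4) * (n1^2 + n2^2 + n3^2 - 2*(n1*n2 + n2*n3 + n3*n1)) = 1

/-- `(O, Sp, Sm, n1, n2, n3)` is a solution of the Wainwright–Hsu system (with
parameter `γ`) on the set `s ⊆ ℝ`, satisfying `Ω ≥ 0` and the constraint. -/
structure SolOn (γ : ℝ) (s : Set ℝ) (O Sp Sm n1 n2 n3 : ℝ → ℝ) : Prop where
  hn1 : ∀ τ ∈ s, HasDerivAt n1 ((qf γ (O τ) (Sp τ) (Sm τ) - 4 * Sp τ) * n1 τ) τ
  hn2 : ∀ τ ∈ s, HasDerivAt n2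
    ((qf γ (O τ) (Sp τ) (Sm τ) + 2 * Sp τ + 2 * Real.sqrt 3 * Sm τ) * n2 τ) τ
  hn3 : ∀ τ ∈ s, HasDerivAt n3
    ((qf γ (O τ) (Sp τ) (Sm τ) + 2 * Sp τ - 2 * Real.sqrt 3 * Sm τ) * n3 τ) τ
  hSp : ∀ τ ∈ s, HasDerivAt Sp
    (-(2 - qf γ (O τ) (Sp τ) (Sm τ)) * Sp τ - 3 * SPf (n1 τ) (n2 τ) (n3 τ)) τ
  hSm : ∀ τ ∈ s, HasDerivAt Sm
    (-(2 - qf γ (O τ) (Sp τ) (Sm τ)) * Sm τ - 3 * SMf (n1 τ) (n2 τ) (n3 τ)) τ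
  hO : ∀ τ ∈ s, HasDerivAt O ((2 * qf γ (O τ) (Sp τ) (Sm τ) - (3*γ - 2)) * O τ) τ
  hOnn : ∀ τ ∈ s, 0 ≤ O τ
  hcon : ∀ τ ∈ s, Constraint (O τ) (Sp τ) (Sm τ) (n1 τ) (n2 τ) (n3 τ)

/-- The solution is of Taub type. -/
def TaubType (s : Set ℝ) (Sp Sm n1 n2 n3 : ℝ → ℝ) : Prop :=
  (∀ τ ∈ s, Sm τ = 0 ∧ n2 τ = n3 τ) ∨
  (∀ τ ∈ s, Sm τ = -(Real.sqrt 3) * Sp τ ∧ n1 τ = n2 τ) ∨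
  (∀ τ ∈ s, Sm τ = Real.sqrt 3 * Sp τ ∧ n3 τ = n1 τ)

/-- The solution converges to the fixed point `F` as `τ → -∞`. -/
def TendstoF (O Sp Sm n1 n2 n3 : ℝ → ℝ) : Prop :=
  Tendsto O atBot (𝓝 1) ∧ Tendsto Sp atBot (𝓝 0) ∧ Tendsto Sm atBot (𝓝 0) ∧
  Tendsto n1 atBot (𝓝 0) ∧ Tendsto n2 atBot (𝓝 0) ∧ Tendsto n3 atBot (𝓝 0)

/-- The solution converges to the fixed point `P₁⁺(II)` as `τ → -∞`. -/
def TendstoP1 (γ : ℝ) (O Sp Sm n1 n2 n3 : ℝ → ℝ) : Prop :=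
  Tendsto O atBot (𝓝 (1 - (3*γ - 2)/16)) ∧
  Tendsto Sp atBot (𝓝 ((3*γ - 2)/8)) ∧ Tendsto Sm atBot (𝓝 0) ∧
  (∃ c : ℝ, 0 < c ∧ Tendsto n1 atBot (𝓝 c)) ∧
  Tendsto n2 atBot (𝓝 0) ∧ Tendsto n3 atBot (𝓝 0)

/-- The solution converges to the fixed point `P₂⁺(II)` as `τ → -∞`. -/
def TendstoP2 (γ : ℝ) (O Sp Sm n1 n2 n3 : ℝ → ℝ) : Prop :=
  Tendsto O atBot (𝓝 (1 - (3*γ - 2)/16)) ∧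
  Tendsto Sp atBot (𝓝 (-((3*γ - 2)/16))) ∧
  Tendsto Sm atBot (𝓝 (-(Real.sqrt 3 * (3*γ - 2)/16))) ∧
  Tendsto n1 atBot (𝓝 0) ∧
  (∃ c : ℝ, 0 < c ∧ Tendsto n2 atBot (𝓝 c)) ∧ Tendsto n3 atBot (𝓝 0)

/-- The solution converges to the fixed point `P₃⁺(II)` as `τ → -∞`. -/
def TendstoP3 (γ : ℝ) (O Sp Sm n1 n2 n3 : ℝ → ℝ) : Prop :=
  Tendsto O atBot (𝓝 (1 - (3*γ - 2)/16)) ∧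
  Tendsto Sp atBot (𝓝 (-((3*γ - 2)/16))) ∧
  Tendsto Sm atBot (𝓝 (Real.sqrt 3 * (3*γ - 2)/16)) ∧
  Tendsto n1 atBot (𝓝 0) ∧ Tendsto n2 atBot (𝓝 0) ∧
  (∃ c : ℝ, 0 < c ∧ Tendsto n3 atBot (𝓝 c))

/-- A Bianchi IX solution is generic if it is not of Taub type and does not
converge to `F` nor to any of the `Pᵢ⁺(II)` as `τ → -∞`. -/
def Generic (γ : ℝ) (s : Set ℝ) (O Sp Sm n1 n2 n3 : ℝ → ℝ) : Prop :=
  ¬ TaubType s Sp Sm n1 n2 n3 ∧ ¬ TendstoF O Sp Sm n1 n2 n3 ∧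
  ¬ TendstoP1 γ O Sp Sm n1 n2 n3 ∧ ¬ TendstoP2 γ O Sp Sm n1 n2 n3 ∧
  ¬ TendstoP3 γ O Sp Sm n1 n2 n3

/-- `(a, b, c, d, e, f)` is an α-limit point of the solution:
some sequence of times tending to `-∞` along which the solution converges to it. -/
def AlphaLim (O Sp Sm n1 n2 n3 : ℝ → ℝ) (a b c d e f : ℝ) : Prop :=
  ∃ τs : ℕ → ℝ, Tendsto τs atTop atBot ∧
    Tendsto (fun k => O (τs k)) atTop (𝓝 a) ∧
    Tendsto (fun k => Sp (τs k)) atTop (𝓝 b) ∧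
    Tendsto (fun k => Sm (τs k)) atTop (𝓝 c) ∧
    Tendsto (fun k => n1 (τs k)) atTop (𝓝 d) ∧
    Tendsto (fun k => n2 (τs k)) atTop (𝓝 e) ∧
    Tendsto (fun k => n3 (τs k)) atTop (𝓝 f)

/-- ω-limit point (times tending to `+∞`). -/
def OmegaLim (O Sp Sm n1 n2 n3 : ℝ → ℝ) (a b c d e f : ℝ) : Prop :=
  ∃ τs : ℕ → ℝ, Tendsto τs atTop atTop ∧
    Tendsto (fun k => O (τs k)) atTop (𝓝 a) ∧
    Tendsto (fun k => Sp (τs k)) atTop (𝓝 b) ∧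
    Tendsto (fun k => Sm (τs k)) atTop (𝓝 c) ∧
    Tendsto (fun k => n1 (τs k)) atTop (𝓝 d) ∧
    Tendsto (fun k => n2 (τs k)) atTop (𝓝 e) ∧
    Tendsto (fun k => n3 (τs k)) atTop (𝓝 f)

/-- α-limit point, phrased for a point of `ℝ⁶` (in coordinates `Ω, Σ₊, Σ₋, N₁, N₂, N₃`). -/
def AlphaLimPt (O Sp Sm n1 n2 n3 : ℝ → ℝ) (p : Fin 6 → ℝ) : Prop :=
  ∃ τs : ℕ → ℝ, Tendsto τs atTop atBot ∧
    Tendsto (fun k =>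
      (![O (τs k), Sp (τs k), Sm (τs k), n1 (τs k), n2 (τs k), n3 (τs k)] : Fin 6 → ℝ))
      atTop (𝓝 p)

/-- A non-special point of the Kasner circle, given by its `(Σ₊, Σ₋)` coordinates. -/
def NonSpecialKasner (a b : ℝ) : Prop :=
  a^2 + b^2 = 1 ∧ (a, b) ≠ (-1, 0) ∧
  (a, b) ≠ (1/2, Real.sqrt 3 / 2) ∧ (a, b) ≠ (1/2, -(Real.sqrt 3) / 2)

/-- The state vector of a solution, as a point of Euclidean `ℝ⁶`. -/
def stateVec (O Sp Sm n1 n2 n3 : ℝ → ℝ) (τ : ℝ) : EuclideanSpace ℝ (Fin 6) :=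
  (WithLp.equiv 2 (Fin 6 → ℝ)).symm ![O τ, Sp τ, Sm τ, n1 τ, n2 τ, n3 τ]

/-- The Bianchi attractor `𝒜`: the closure of the vacuum type I and II points, i.e. the
points of `ℝ⁶` satisfying the constraint with `Ω = 0` and `N₁N₂ = N₂N₃ = N₃N₁ = 0`. -/
def attractor : Set (EuclideanSpace ℝ (Fin 6)) :=
  {y | Constraint (y 0) (y 1) (y 2) (y 3) (y 4) (y 5) ∧
    y 0 = 0 ∧ y 3 * y 4 = 0 ∧ y 4 * y 5 = 0 ∧ y 5 * y 3 = 0}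


/-- Convergence to a point `(0, -1, 0, 0, n₂, n₂)` with `0 < n₂ < ∞`. -/
def TaubLimit (O Sp Sm n1 n2 n3 : ℝ → ℝ) : Prop :=
  Tendsto O atBot (𝓝 0) ∧ Tendsto Sp atBot (𝓝 (-1)) ∧ Tendsto Sm atBot (𝓝 0) ∧
  Tendsto n1 atBot (𝓝 0) ∧
  ∃ c : ℝ, 0 < c ∧ Tendsto n2 atBot (𝓝 c) ∧ Tendsto n3 atBot (𝓝 c)

/-! ### Generic lemmas on asymptotics at `-∞` -/

lemma mono_of_deriv' {f f' : ℝ → ℝ} {T : ℝ} (hf : ∀ τ ≤ T, HasDerivAt f (f' τ) τ)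
    (h : ∀ τ ≤ T, 0 ≤ f' τ) : MonotoneOn f (Iic T) := by
  apply monotoneOn_of_deriv_nonneg (convex_Iic T)
  · intro τ hτ
    exact (hf τ hτ).continuousAt.continuousWithinAt
  · intro τ hτ
    rw [interior_Iic] at hτ
    exact (hf τ (le_of_lt hτ)).differentiableAt.differentiableWithinAt
  · intro τ hτ
    rw [interior_Iic] at hτ
    rw [(hf τ (le_of_lt hτ)).deriv]
    exact h τ (le_of_lt hτ)

lemma conv_of_mono {f : ℝ → ℝ} {T B : ℝ} (hf : MonotoneOn f (Iic T))
    (hB : ∀ τ ≤ T, B ≤ f τ) : ∃ l, Tendsto f atBot (𝓝 l) := by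
  have hm : Monotone (fun τ => f (min τ T)) := by
    intro x y hxy
    exact hf (mem_Iic.2 (min_le_right _ _)) (mem_Iic.2 (min_le_right _ _)) (min_le_min_right _ hxy)
  have hb : BddBelow (range (fun τ => f (min τ T))) := by
    refine ⟨B, ?_⟩
    rintro _ ⟨τ, rfl⟩
    exact hB _ (min_le_right _ _)
  refine ⟨_, (tendsto_atBot_ciInf hm hb).congr' ?_⟩
  filter_upwards [eventually_le_atBot T] with τ hτ
  simp [min_eq_left hτ]

lemma grow_of_deriv {f f' : ℝ → ℝ} {T c : ℝ} (hf : ∀ τ ≤ T, HasDerivAt f (f' τ) τ)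
    (h : ∀ τ ≤ T, c ≤ f' τ) : ∀ τ ≤ T, f τ ≤ f T - c * (T - τ) := by
  have hm : MonotoneOn (fun τ => f τ - c * τ) (Iic T) := by
    apply mono_of_deriv' (f' := fun τ => f' τ - c)
    · intro τ hτ
      exact ((hf τ hτ).fun_sub ((hasDerivAt_id τ).const_mul c)).congr_deriv (by ring)
    · intro τ hτ
      have := h τ hτ
      linarith
  intro τ hτ
  have := hm hτ (mem_Iic.2 le_rfl) hτ
  simp only at this
  linarith

lemma tendsto_atBot_of_grow {f f' : ℝ → ℝ} {T c : ℝ} (hc : 0 < c)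
    (hf : ∀ τ ≤ T, HasDerivAt f (f' τ) τ)
    (h : ∀ τ ≤ T, c ≤ f' τ) : Tendsto f atBot atBot := by
  have h1 : Tendsto (fun τ => f T - c * T + c * τ) atBot atBot :=
    tendsto_atBot_add_const_left _ _ (tendsto_id.const_mul_atBot hc)
  refine tendsto_atBot_mono' _ ?_ h1
  filter_upwards [eventually_le_atBot T] with τ hτ
  have := grow_of_deriv hf h τ hτ
  linarith

lemma limit_deriv_nonpos {f f' : ℝ → ℝ} {T l d : ℝ}
    (hf : ∀ τ ≤ T, HasDerivAt f (f' τ) τ) (hl : Tendsto f atBot (𝓝 l))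
    (hd : Tendsto f' atBot (𝓝 d)) : d ≤ 0 := by
  by_contra hcon
  push Not at hcon
  have h1 : ∀ᶠ τ in atBot, d / 2 ≤ f' τ :=
    (hd.eventually (lt_mem_nhds (show d / 2 < d by linarith))).mono fun _ h => h.le
  obtain ⟨S, hS⟩ := eventually_atBot.1 h1
  have := tendsto_atBot_of_grow (T := min S T) (c := d / 2) (by linarith)
    (fun τ hτ => hf τ (hτ.trans (min_le_right _ _)))
    (fun τ hτ => hS τ (hτ.trans (min_le_left _ _)))
  exact not_tendsto_nhds_of_tendsto_atBot this l hl

lemma limit_deriv_zero {f f' : ℝ → ℝ} {T l d : ℝ}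
    (hf : ∀ τ ≤ T, HasDerivAt f (f' τ) τ) (hl : Tendsto f atBot (𝓝 l))
    (hd : Tendsto f' atBot (𝓝 d)) : d = 0 := by
  have h1 := limit_deriv_nonpos hf hl hd
  have h2 := limit_deriv_nonpos (f := fun τ => - f τ) (f' := fun τ => - f' τ)
    (fun τ hτ => (hf τ hτ).neg) hl.neg hd.neg
  linarith

/-- If `|f'| ≤ F'` and `F` is bounded below then `f` converges at `-∞`. -/
lemma conv_of_dom {f f' F F' : ℝ → ℝ} {T B : ℝ}
    (hf : ∀ τ ≤ T, HasDerivAt f (f' τ) τ) (hF : ∀ τ ≤ T, HasDerivAt F (F' τ) τ)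
    (h : ∀ τ ≤ T, |f' τ| ≤ F' τ) (hB : ∀ τ ≤ T, B ≤ F τ) :
    ∃ l, Tendsto f atBot (𝓝 l) := by
  have m0 : MonotoneOn F (Iic T) := mono_of_deriv' hF
    (fun τ hτ => (abs_nonneg _).trans (h τ hτ))
  have m1 : MonotoneOn (fun τ => F τ + f τ) (Iic T) :=
    mono_of_deriv' (fun τ hτ => (hF τ hτ).add (hf τ hτ))
      (fun τ hτ => by have := abs_le.1 (h τ hτ); linarith)
  have m2 : MonotoneOn (fun τ => F τ - f τ) (Iic T) :=
    mono_of_deriv' (fun τ hτ => (hF τ hτ).sub (hf τ hτ))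
      (fun τ hτ => by have := abs_le.1 (h τ hτ); linarith)
  obtain ⟨l0, h0⟩ := conv_of_mono m0 hB
  obtain ⟨l1, h1⟩ := conv_of_mono (B := B + (B - (F T - f T))) m1 (fun τ hτ => by
    have h2 := m2 hτ (mem_Iic.2 le_rfl) hτ
    have h3 := hB τ hτ
    simp only at h2 ⊢
    linarith)
  exact ⟨l1 - l0, by simpa using h1.sub h0⟩

/-- A Barbalat type lemma. -/
lemma barbalat {y y' F F' : ℝ → ℝ} {T B c K : ℝ} (hc : 0 < c)
    (hy : ∀ τ ≤ T, HasDerivAt y (y' τ) τ) (hF : ∀ τ ≤ T, HasDerivAt F (F' τ) τ)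
    (hK : ∀ τ ≤ T, |y' τ| ≤ K)
    (h : ∀ τ ≤ T, c * (y τ) ^ 2 ≤ F' τ) (hB : ∀ τ ≤ T, B ≤ F τ) :
    Tendsto y atBot (𝓝 0) := by
  have hK0 : 0 ≤ K := (abs_nonneg _).trans (hK T le_rfl)
  obtain ⟨l, hl⟩ := conv_of_dom (f := fun τ => (y τ) ^ 3) (f' := fun τ => 3 * (y τ) ^ 2 * y' τ)
    (F := fun τ => (3 * K / c) * F τ) (F' := fun τ => (3 * K / c) * F' τ) (T := T)
    (B := (3 * K / c) * B)
    (fun τ hτ => ((hy τ hτ).fun_pow 3).congr_deriv (by norm_num))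
    (fun τ hτ => (hF τ hτ).const_mul _)
    (fun τ hτ => by
      have h1 := hK τ hτ
      have h2 := h τ hτ
      rw [abs_mul, abs_of_nonneg (by positivity : (0:ℝ) ≤ 3 * (y τ) ^ 2)]
      calc 3 * (y τ) ^ 2 * |y' τ| ≤ 3 * (y τ) ^ 2 * K := by gcongr
        _ = (3 * K / c) * (c * (y τ) ^ 2) := by field_simp
        _ ≤ _ := by gcongr)
    (fun τ hτ => by have := hB τ hτ; gcongr)
  have m0 : MonotoneOn F (Iic T) := mono_of_deriv' hF
    (fun τ hτ => (by positivity : 0 ≤ c * (y τ) ^ 2).trans (h τ hτ))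
  obtain ⟨l0, h0⟩ := conv_of_mono m0 hB
  have hl0 : l = 0 := by
    by_contra hne
    have hlp : 0 < |l| := abs_pos.2 hne
    have hcube : ∀ᶠ τ in atBot, |l| / 2 < |(y τ) ^ 3| :=
      hl.abs.eventually (lt_mem_nhds (by linarith))
    set m := min (|l| / 2) 1 with hm
    have hmpos : 0 < m := lt_min (by linarith) one_pos
    have hge : ∀ᶠ τ in atBot, c * m ^ 2 ≤ F' τ := by
      filter_upwards [hcube, eventually_le_atBot T] with τ h1 hτ
      have h2 := h τ hτ
      have h3 : m ≤ |y τ| := by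
        by_contra hlt
        push Not at hlt
        have hle1 : |y τ| ≤ 1 := hlt.le.trans (min_le_right _ _)
        have : |(y τ) ^ 3| ≤ |y τ| := by
          rw [abs_pow]
          calc |y τ| ^ 3 ≤ |y τ| ^ 1 := pow_le_pow_of_le_one (abs_nonneg _) hle1 (by norm_num)
            _ = _ := pow_one _
        have : m ≤ |l| / 2 := min_le_left _ _
        linarith
      have h4 : m ^ 2 ≤ (y τ) ^ 2 := by
        rw [← sq_abs (y τ)]
        gcongr
      nlinarith
    obtain ⟨S, hS⟩ := eventually_atBot.1 hge
    have := tendsto_atBot_of_grow (T := min S T) (c := c * m ^ 2) (by positivity)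
      (fun τ hτ => hF τ (hτ.trans (min_le_right _ _)))
      (fun τ hτ => hS τ (hτ.trans (min_le_left _ _)))
    exact not_tendsto_nhds_of_tendsto_atBot this l0 h0
  rw [hl0] at hl
  rw [Metric.tendsto_nhds] at hl ⊢
  intro e he
  filter_upwards [hl (e ^ 3) (by positivity)] with τ h1
  rw [Real.dist_eq, sub_zero] at h1 ⊢
  rw [abs_pow] at h1
  exact lt_of_pow_lt_pow_left₀ 3 he.le h1

lemma exp_deriv (A e : ℝ) (τ : ℝ) :
    HasDerivAt (fun t => A * Real.exp (e * t)) (A * e * Real.exp (e * τ)) τ := by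
  have h := (((hasDerivAt_id τ).const_mul e).exp).const_mul A
  exact h.congr_deriv (by simp only [id]; ring)

lemma exp_tendsto {e : ℝ} (he : 0 < e) (A : ℝ) :
    Tendsto (fun t => A * Real.exp (e * t)) atBot (𝓝 0) := by
  have := (Real.tendsto_exp_atBot.comp (tendsto_id.const_mul_atBot he)).const_mul A
  simpa using this

/-! ### The reduced system -/

/-- The reduced (Taub) system in the variables `s = Σ₊`, `X = 3N₁²/4`, `O = Ω`, `P = 3N₁N₂`,
`M = N₂`, with `v = (3γ-2)/8`. -/
structure Red (v T : ℝ) (s X O P M : ℝ → ℝ) : Prop where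
  v0 : 0 < v
  v1 : v < 1 / 2
  ds : ∀ τ ≤ T, HasDerivAt s
    (-(2 - (4 * v * O τ + 2 * s τ ^ 2)) * s τ + 4 * X τ - P τ) τ
  dX : ∀ τ ≤ T, HasDerivAt X (2 * ((4 * v * O τ + 2 * s τ ^ 2) - 4 * s τ) * X τ) τ
  dO : ∀ τ ≤ T, HasDerivAt O ((2 * (4 * v * O τ + 2 * s τ ^ 2) - 8 * v) * O τ) τ
  dP : ∀ τ ≤ T, HasDerivAt P (2 * ((4 * v * O τ + 2 * s τ ^ 2) - s τ) * P τ) τ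
  dM : ∀ τ ≤ T, HasDerivAt M (((4 * v * O τ + 2 * s τ ^ 2) + 2 * s τ) * M τ) τ
  X0 : ∀ τ ≤ T, 0 < X τ
  P0 : ∀ τ ≤ T, 0 < P τ
  M0 : ∀ τ ≤ T, 0 < M τ
  O0 : ∀ τ ≤ T, 0 ≤ O τ
  con : ∀ τ ≤ T, O τ + s τ ^ 2 + X τ = 1 + P τ

lemma Red.mono {v T T' : ℝ} {s X O P M : ℝ → ℝ} (h : Red v T s X O P M) (hT : T' ≤ T) :
    Red v T' s X O P M :=
  ⟨h.v0, h.v1, fun τ hτ => h.ds τ (hτ.trans hT), fun τ hτ => h.dX τ (hτ.trans hT),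
    fun τ hτ => h.dO τ (hτ.trans hT), fun τ hτ => h.dP τ (hτ.trans hT),
    fun τ hτ => h.dM τ (hτ.trans hT), fun τ hτ => h.X0 τ (hτ.trans hT),
    fun τ hτ => h.P0 τ (hτ.trans hT), fun τ hτ => h.M0 τ (hτ.trans hT),
    fun τ hτ => h.O0 τ (hτ.trans hT), fun τ hτ => h.con τ (hτ.trans hT)⟩

/-- `P` decays exponentially towards the past. -/
lemma Red.decay {v : ℝ} {s X O P M : ℝ → ℝ} (h : Red v 0 s X O P M) :
    ∃ e C : ℝ, 0 < e ∧ 0 < C ∧ ∀ τ ≤ 0, P τ ≤ C * Real.exp (e * τ) := by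
  have hv := h.v0
  set Y : ℝ → ℝ := fun τ => 2 * Real.log (P τ) - 1 / 2 * Real.log (X τ) with hY
  have dY : ∀ τ ≤ 0, HasDerivAt Y (3 * (4 * v * O τ + 2 * s τ ^ 2)) τ := by
    intro τ hτ
    have hP := h.P0 τ hτ
    have hX := h.X0 τ hτ
    have := (((h.dP τ hτ).log hP.ne').const_mul 2).sub
      (((h.dX τ hτ).log hX.ne').const_mul (1 / 2))
    exact this.congr_deriv (by field_simp; ring)
  have hq : ∀ τ ≤ 0, 0 ≤ 4 * v * O τ + 2 * s τ ^ 2 := by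
    intro τ hτ
    have := h.O0 τ hτ
    positivity
  have mY : MonotoneOn Y (Iic 0) := mono_of_deriv' dY (fun τ hτ => by
    have := hq τ hτ
    linarith)
  -- 4 log P ≤ 2 Y + log (1+P)
  have key : ∀ τ ≤ 0, 4 * Real.log (P τ) ≤ 2 * Y τ + Real.log (1 + P τ) := by
    intro τ hτ
    have hX := h.X0 τ hτ
    have hO := h.O0 τ hτ
    have hc := h.con τ hτ
    have : Real.log (X τ) ≤ Real.log (1 + P τ) :=
      Real.log_le_log hX (by nlinarith [sq_nonneg (s τ)])
    simp only [hY]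
    linarith
  set E := Real.exp (2 * Y 0) with hE
  have hE0 : 0 < E := Real.exp_pos _
  have hPB : ∀ τ ≤ 0, P τ ≤ 1 + 2 * E := by
    intro τ hτ
    have hP := h.P0 τ hτ
    have hk := key τ hτ
    have hY0 : Y τ ≤ Y 0 := mY hτ (mem_Iic.2 le_rfl) hτ
    have h4 : P τ ^ 4 ≤ E * (1 + P τ) := by
      have h5 : Real.log (P τ ^ 4) ≤ Real.log (E * (1 + P τ)) := by
        rw [Real.log_pow, Real.log_mul hE0.ne' (by linarith), hE, Real.log_exp]
        push_cast
        linarith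
      exact (Real.log_le_log_iff (by positivity) (by positivity)).1 h5
    by_contra hcon
    push Not at hcon
    have h1 : 1 < P τ := by linarith
    have h2 : P τ ^ 4 ≥ P τ * P τ := by
      have : P τ ^ 4 = P τ * P τ * (P τ * P τ) := by ring
      have h3 : 1 ≤ P τ * P τ := by nlinarith
      nlinarith
    nlinarith
  set S := 1 + (1 + 2 * E) with hS
  have hsS : ∀ τ ≤ 0, |s τ| ≤ S := by
    intro τ hτ
    have hc := h.con τ hτ
    have hX := h.X0 τ hτ
    have hO := h.O0 τ hτ
    have hB := hPB τ hτ
    apply abs_le_of_sq_le_sq _ (by linarith)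
    nlinarith
  set K := 1 / (4 * v) + 3 / 2 + S with hK
  have hKpos : 0 < K := by positivity
  have dPhi : ∀ τ ≤ 0, HasDerivAt (fun τ => s τ + K / 3 * Y τ)
      ((-(2 - (4 * v * O τ + 2 * s τ ^ 2)) * s τ + 4 * X τ - P τ) +
        K / 3 * (3 * (4 * v * O τ + 2 * s τ ^ 2))) τ :=
    fun τ hτ => (h.ds τ hτ).add ((dY τ hτ).const_mul _)
  have hPhi := grow_of_deriv dPhi (c := 1 / 2) (fun τ hτ => by
    have hc := h.con τ hτ
    have hX := h.X0 τ hτ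
    have hO := h.O0 τ hτ
    have hq := hq τ hτ
    have hs := (abs_le.1 (hsS τ hτ)).1
    set q := 4 * v * O τ + 2 * s τ ^ 2 with hqdef
    have e1 : 1 / (4 * v) * q ≥ O τ := by
      have : 1 / (4 * v) * q = O τ + 1 / (4 * v) * (2 * s τ ^ 2) := by
        rw [hqdef]; field_simp
      rw [this]
      have : 0 ≤ 1 / (4 * v) * (2 * s τ ^ 2) := by positivity
      linarith
    have e2 : q * s τ ≥ - (S * q) := by nlinarith
    have e3 : 3 / 2 * q ≥ 3 * s τ ^ 2 := by
      rw [hqdef]; nlinarith [mul_nonneg hv.le hO]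
    have e4 : K / 3 * (3 * q) = 1 / (4 * v) * q + 3 / 2 * q + S * q := by
      rw [hK]; ring
    rw [e4]
    nlinarith [sq_nonneg (2 * s τ - 1)])
  set Φ0 := s 0 + K / 3 * Y 0
  set C0 := (2 * ((3 / K) * (Φ0 + S)) + Real.log (2 + 2 * E)) / 4 with hC0
  refine ⟨3 / (4 * K), Real.exp C0, by positivity, Real.exp_pos _, ?_⟩
  intro τ hτ
  have h1 := hPhi τ hτ
  have h2 := (abs_le.1 (hsS τ hτ)).1
  have h3 := key τ hτ
  have hP := h.P0 τ hτ
  have h4 : Real.log (1 + P τ) ≤ Real.log (2 + 2 * E) :=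
    Real.log_le_log (by linarith) (by linarith [hPB τ hτ])
  have h5 : Y τ ≤ (3 / K) * (Φ0 + S) + (3 / K) * (τ / 2) := by
    have : K / 3 * Y τ ≤ Φ0 + S + τ / 2 := by linarith
    calc Y τ = (3 / K) * (K / 3 * Y τ) := by field_simp
      _ ≤ (3 / K) * (Φ0 + S + τ / 2) := by gcongr
      _ = _ := by ring
  have h6 : Real.log (P τ) ≤ C0 + 3 / (4 * K) * τ := by
    have : 3 / (4 * K) * τ = 2 * ((3 / K) * (τ / 2)) / 4 := by field_simp
    rw [this, hC0]
    linarith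
  calc P τ = Real.exp (Real.log (P τ)) := (Real.exp_log hP).symm
    _ ≤ Real.exp (C0 + 3 / (4 * K) * τ) := Real.exp_le_exp.2 h6
    _ = _ := Real.exp_add _ _

lemma limit_nonpos_of_le {f f' g : ℝ → ℝ} {T l d : ℝ}
    (hf : ∀ τ ≤ T, HasDerivAt f (f' τ) τ) (hl : Tendsto f atBot (𝓝 l))
    (hg : ∀ τ ≤ T, g τ ≤ f' τ)
    (hd : Tendsto g atBot (𝓝 d)) : d ≤ 0 := by
  by_contra hcon
  push Not at hcon
  have h1 : ∀ᶠ τ in atBot, d / 2 ≤ g τ :=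
    (hd.eventually (lt_mem_nhds (show d / 2 < d by linarith))).mono fun _ h => h.le
  obtain ⟨S, hS⟩ := eventually_atBot.1 h1
  have := tendsto_atBot_of_grow (T := min S T) (c := d / 2) (by linarith)
    (fun τ hτ => hf τ (hτ.trans (min_le_right _ _)))
    (fun τ hτ => (hS τ (hτ.trans (min_le_left _ _))).trans (hg τ (hτ.trans (min_le_right _ _))))
  exact not_tendsto_nhds_of_tendsto_atBot this l hl

/-- The reduced system with exponentially decaying, small `P`. -/
structure Red2 (v T e C : ℝ) (s X O P M : ℝ → ℝ) : Prop extends Red v T s X O P M where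
  e0 : 0 < e
  C0 : 0 < C
  P1 : ∀ τ ≤ T, P τ ≤ 1
  Pe : ∀ τ ≤ T, P τ ≤ C * Real.exp (e * τ)

section red2

variable {v T e C : ℝ} {s X O P M : ℝ → ℝ}

lemma Red2.mono2 (h : Red2 v T e C s X O P M) {T' : ℝ} (hT : T' ≤ T) :
    Red2 v T' e C s X O P M :=
  ⟨h.toRed.mono hT, h.e0, h.C0, fun τ hτ => h.P1 τ (hτ.trans hT),
    fun τ hτ => h.Pe τ (hτ.trans hT)⟩

lemma Red2.Plim (h : Red2 v T e C s X O P M) : Tendsto P atBot (𝓝 0) := by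
  refine tendsto_of_tendsto_of_tendsto_of_le_of_le' tendsto_const_nhds
    (exp_tendsto h.e0 C) ?_ ?_
  · filter_upwards [eventually_le_atBot T] with τ hτ using (h.P0 τ hτ).le
  · filter_upwards [eventually_le_atBot T] with τ hτ using h.Pe τ hτ

lemma Red2.bounds (h : Red2 v T e C s X O P M) {τ : ℝ} (hτ : τ ≤ T) :
    s τ ^ 2 ≤ 2 ∧ O τ ≤ 2 ∧ X τ ≤ 2 ∧ s τ ≤ 3 / 2 ∧ -(3 / 2) ≤ s τ := by
  have h1 := h.con τ hτ
  have h2 := h.X0 τ hτ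
  have h3 := h.O0 τ hτ
  have h4 := h.P1 τ hτ
  have h5 := sq_nonneg (s τ)
  refine ⟨by linarith, by linarith, by linarith, by nlinarith, by nlinarith⟩

lemma Red2.ds' (h : Red2 v T e C s X O P M) : ∀ τ ≤ T, HasDerivAt s
    (X τ * (4 - 2 * s τ) - (2 - 4 * v) * O τ * s τ - (1 - 2 * s τ) * P τ) τ := by
  intro τ hτ
  exact (h.ds τ hτ).congr_deriv (by linear_combination (2 * s τ) * h.con τ hτ)

/-- Once `Σ₊` is negative enough, it remains so towards the past. -/
lemma Red2.trap (h : Red2 v T e C s X O P M) {τ₀ : ℝ} (h0 : τ₀ ≤ T)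
    (hneg : s τ₀ + 5 * C / e * Real.exp (e * τ₀) < 0) :
    ∀ τ ≤ τ₀, s τ + 5 * C / e * Real.exp (e * τ) ≤ s τ₀ + 5 * C / e * Real.exp (e * τ₀) := by
  intro τ hτ
  have he := h.e0
  have hC := h.C0
  set f : ℝ → ℝ := fun τ => s τ + 5 * C / e * Real.exp (e * τ) with hf
  have df : ∀ τ ≤ T, HasDerivAt f ((X τ * (4 - 2 * s τ) - (2 - 4 * v) * O τ * s τ
      - (1 - 2 * s τ) * P τ) + 5 * C / e * e * Real.exp (e * τ)) τ :=
    fun τ hτ => (h.ds' τ hτ).fun_add (exp_deriv _ _ _)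
  have dg : ∀ t, -τ₀ ≤ t → HasDerivAt (fun t => f (-t)) (-((X (-t) * (4 - 2 * s (-t))
      - (2 - 4 * v) * O (-t) * s (-t)
      - (1 - 2 * s (-t)) * P (-t)) + 5 * C / e * e * Real.exp (e * (-t)))) t := by
    intro t ht
    have := (df (-t) (by linarith)).scomp t (hasDerivAt_neg t)
    exact this.congr_deriv (by simp)
  have key := image_le_of_deriv_right_lt_deriv_boundary' (f := fun t => f (-t)) (a := -τ₀)
    (b := -τ) (B := fun _ => f τ₀) (B' := fun _ => 0)
    (f' := fun t => (-((X (-t) * (4 - 2 * s (-t))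
      - (2 - 4 * v) * O (-t) * s (-t)
      - (1 - 2 * s (-t)) * P (-t)) + 5 * C / e * e * Real.exp (e * (-t)))))
    (fun t ht => (dg t ht.1).continuousAt.continuousWithinAt)
    (fun t ht => (dg t ht.1).hasDerivWithinAt)
    (by simp) continuousOn_const (fun t _ => hasDerivWithinAt_const _ _ _)
    (by
      intro t ht heq
      have htT : -t ≤ T := by have := ht.1; linarith
      have hs : s (-t) < 0 := by
        have h1 : f (-t) < 0 := by rw [heq]; exact hneg
        have h2 : 0 < 5 * C / e * Real.exp (e * (-t)) := by positivity
        simp only [hf] at h1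
        linarith
      have h1 := h.X0 _ htT
      have h2 := h.O0 _ htT
      have h3 := h.P0 _ htT
      have h4 := h.Pe _ htT
      obtain ⟨-, -, -, -, hb⟩ := h.bounds htT
      have hv := h.v1
      have h5 : 5 * C / e * e = 5 * C := by field_simp
      rw [h5]
      have h6 : 0 < X (-t) * (4 - 2 * s (-t)) := by
        apply mul_pos h1; linarith
      have h7 : 0 ≤ (2 - 4 * v) * O (-t) * (- s (-t)) := by
        apply mul_nonneg (mul_nonneg _ h2) <;> linarith
      have h8 : (1 - 2 * s (-t)) * P (-t) ≤ 5 * P (-t) := by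
        apply mul_le_mul_of_nonneg_right _ h3.le; linarith
      linarith)
  have := key (x := -τ) ⟨by linarith, le_rfl⟩
  simpa using this

/-- Convergence in the trapped case. -/
lemma Red2.caseA (h : Red2 v T e C s X O P M) {m : ℝ} (hm : 0 < m)
    (hs : ∀ τ ≤ T, s τ ≤ -m) :
    Tendsto O atBot (𝓝 0) ∧ Tendsto s atBot (𝓝 (-1)) ∧ Tendsto X atBot (𝓝 0) ∧
      ∃ c, 0 < c ∧ Tendsto M atBot (𝓝 c) := by
  have he := h.e0
  have hC := h.C0
  have hv := h.v1
  have hv0 := h.v0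
  set δ := min 1 ((2 - 4 * v) * m) with hδ
  have hδ0 : 0 < δ := lt_min one_pos (mul_pos (by linarith) hm)
  have hds : ∀ τ ≤ T, δ * (X τ + O τ) - 5 * P τ ≤
      X τ * (4 - 2 * s τ) - (2 - 4 * v) * O τ * s τ - (1 - 2 * s τ) * P τ := by
    intro τ hτ
    have h1 := h.X0 τ hτ
    have h2 := h.O0 τ hτ
    have h3 := h.P0 τ hτ
    obtain ⟨-, -, -, -, hb⟩ := h.bounds hτ
    have hsm := hs τ hτ
    have e1 : δ * X τ ≤ 1 * X τ := mul_le_mul_of_nonneg_right (min_le_left _ _) h1.le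
    have e2 : δ * O τ ≤ (2 - 4 * v) * m * O τ :=
      mul_le_mul_of_nonneg_right (min_le_right _ _) h2
    have e3 : 0 ≤ (2 - 4 * v) * O τ * (- s τ - m) := by
      apply mul_nonneg (mul_nonneg _ h2) <;> linarith
    have e4 : (1 - 2 * s τ) * P τ ≤ 5 * P τ := by
      apply mul_le_mul_of_nonneg_right _ h3.le; linarith
    have e5 : 0 ≤ X τ * (3 - 2 * s τ) := by
      apply mul_nonneg h1.le; linarith
    nlinarith
  have dF : ∀ τ ≤ T, HasDerivAt (fun τ => s τ + 5 * C / e * Real.exp (e * τ))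
      ((X τ * (4 - 2 * s τ) - (2 - 4 * v) * O τ * s τ
      - (1 - 2 * s τ) * P τ) + 5 * C * Real.exp (e * τ)) τ :=
    fun τ hτ => ((h.ds' τ hτ).fun_add (exp_deriv _ _ _)).congr_deriv (by field_simp)
  have hF' : ∀ τ ≤ T, δ * (X τ + O τ) ≤ (X τ * (4 - 2 * s τ) - (2 - 4 * v) * O τ * s τ
      - (1 - 2 * s τ) * P τ) + 5 * C * Real.exp (e * τ) := by
    intro τ hτ
    have := hds τ hτ
    have := h.Pe τ hτ
    linarith
  have hXO : ∀ τ ≤ T, 0 ≤ X τ + O τ := fun τ hτ => add_nonneg (h.X0 τ hτ).le (h.O0 τ hτ)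
  have hFb : ∀ τ ≤ T, -(3 / 2) ≤ s τ + 5 * C / e * Real.exp (e * τ) := by
    intro τ hτ
    obtain ⟨-, -, -, -, hb⟩ := h.bounds hτ
    have : 0 < 5 * C / e * Real.exp (e * τ) := by positivity
    linarith
  obtain ⟨σ, hσ⟩ := conv_of_mono (mono_of_deriv' dF (fun τ hτ =>
    (mul_nonneg hδ0.le (hXO τ hτ)).trans (hF' τ hτ))) hFb
  have hsσ : Tendsto s atBot (𝓝 σ) := by
    simpa using hσ.sub (exp_tendsto he (5 * C / e))
  have hXOlim : Tendsto (fun τ => X τ + O τ) atBot (𝓝 (1 - σ ^ 2)) := by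
    have : Tendsto (fun τ => 1 + P τ - s τ ^ 2) atBot (𝓝 (1 + 0 - σ ^ 2)) :=
      (h.Plim.const_add 1).sub (hsσ.pow 2)
    rw [add_zero] at this
    refine this.congr' ?_
    filter_upwards [eventually_le_atBot T] with τ hτ
    linarith [h.con τ hτ]
  have h1 : δ * (1 - σ ^ 2) ≤ 0 := limit_nonpos_of_le dF hσ hF' (hXOlim.const_mul δ)
  have h2 : 0 ≤ 1 - σ ^ 2 := ge_of_tendsto hXOlim (by
    filter_upwards [eventually_le_atBot T] with τ hτ using hXO τ hτ)
  have h3 : σ ≤ -m := le_of_tendsto hsσ (by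
    filter_upwards [eventually_le_atBot T] with τ hτ using hs τ hτ)
  have h4 : 1 - σ ^ 2 = 0 := by nlinarith
  have h5 : σ = -1 := by
    have : (1 - σ) * (1 + σ) = 0 := by linarith
    rcases mul_eq_zero.1 this with h | h <;> linarith
  rw [h4] at hXOlim
  rw [h5] at hsσ
  have hO : Tendsto O atBot (𝓝 0) := by
    refine tendsto_of_tendsto_of_tendsto_of_le_of_le' tendsto_const_nhds hXOlim ?_ ?_
    · filter_upwards [eventually_le_atBot T] with τ hτ using h.O0 τ hτ
    · filter_upwards [eventually_le_atBot T] with τ hτ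
      linarith [h.X0 τ hτ]
  have hX : Tendsto X atBot (𝓝 0) := by
    refine tendsto_of_tendsto_of_tendsto_of_le_of_le' tendsto_const_nhds hXOlim ?_ ?_
    · filter_upwards [eventually_le_atBot T] with τ hτ using (h.X0 τ hτ).le
    · filter_upwards [eventually_le_atBot T] with τ hτ
      linarith [h.O0 τ hτ]
  refine ⟨hO, hsσ, hX, ?_⟩
  have dlM : ∀ τ ≤ T, HasDerivAt (fun τ => Real.log (M τ))
      ((4 * v * O τ + 2 * s τ ^ 2) + 2 * s τ) τ := by
    intro τ hτ
    have hM := h.M0 τ hτ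
    exact ((h.dM τ hτ).log hM.ne').congr_deriv (by field_simp)
  obtain ⟨l, hl⟩ := conv_of_dom (F := fun τ =>
      5 / δ * (s τ + 5 * C / e * Real.exp (e * τ)) + 5 * C / e * Real.exp (e * τ))
    (F' := fun τ => 5 / δ * ((X τ * (4 - 2 * s τ) - (2 - 4 * v) * O τ * s τ
      - (1 - 2 * s τ) * P τ) + 5 * C * Real.exp (e * τ)) + 5 * C * Real.exp (e * τ))
    (B := 5 / δ * (-(3 / 2))) dlM
    (fun τ hτ => (((dF τ hτ).const_mul _).fun_add (exp_deriv _ _ _)).congr_deriv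
      (by field_simp))
    (by
      intro τ hτ
      have e1 : 5 * (X τ + O τ) ≤ 5 / δ * ((X τ * (4 - 2 * s τ) - (2 - 4 * v) * O τ * s τ
          - (1 - 2 * s τ) * P τ) + 5 * C * Real.exp (e * τ)) := by
        calc 5 * (X τ + O τ) = 5 / δ * (δ * (X τ + O τ)) := by field_simp
          _ ≤ _ := by
            apply mul_le_mul_of_nonneg_left (hF' τ hτ)
            positivity
      have e2 := h.Pe τ hτ
      have e3 := h.P0 τ hτ
      have e4 := h.O0 τ hτ
      have e5 := h.X0 τ hτ
      obtain ⟨-, -, -, -, hb⟩ := h.bounds hτ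
      have e6 := hs τ hτ
      have e7 : (1 - s τ) * (1 + s τ) = X τ + O τ - P τ := by linarith [h.con τ hτ]
      have e8 : |1 + s τ| ≤ X τ + O τ + P τ := by
        have : |1 + s τ| ≤ |(1 - s τ) * (1 + s τ)| := by
          rw [abs_mul]
          have : 1 ≤ |1 - s τ| := by rw [abs_of_nonneg] <;> linarith
          nlinarith [abs_nonneg (1 + s τ)]
        refine this.trans ?_
        rw [e7, abs_le]
        constructor <;> linarith
      have e9 : |(4 * v * O τ + 2 * s τ ^ 2) + 2 * s τ| ≤ 5 * (X τ + O τ) + 5 * P τ := by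
        have f1 : (4 * v * O τ + 2 * s τ ^ 2) + 2 * s τ = 4 * v * O τ + 2 * s τ * (1 + s τ) := by
          ring
        rw [f1]
        have f2 : |4 * v * O τ| ≤ 2 * O τ := by
          rw [abs_of_nonneg (by positivity)]
          nlinarith
        have f3 : |2 * s τ * (1 + s τ)| ≤ 3 * (X τ + O τ + P τ) := by
          rw [abs_mul]
          have : |2 * s τ| ≤ 3 := by rw [abs_le]; constructor <;> linarith
          exact mul_le_mul this e8 (abs_nonneg _) (by norm_num)
        have := abs_add_le (4 * v * O τ) (2 * s τ * (1 + s τ))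
        linarith
      linarith)
    (by
      intro τ hτ
      have e1 := hFb τ hτ
      have e2 : 0 < 5 * C / e * Real.exp (e * τ) := by positivity
      have e3 := mul_le_mul_of_nonneg_left e1 (by positivity : 0 ≤ 5 / δ)
      linarith)
  refine ⟨Real.exp l, Real.exp_pos _, ((Real.continuous_exp.tendsto l).comp hl).congr' ?_⟩
  filter_upwards [eventually_le_atBot T] with τ hτ
  exact Real.exp_log (h.M0 τ hτ)

/-- Convergence to `F`. -/
lemma Red2.caseB (h : Red2 v T e C s X O P M) {A e2 C2 : ℝ} (hA : 0 ≤ A) (he2 : 0 < e2)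
    (hC2 : 0 ≤ C2)
    (hs : ∀ τ ≤ T, -(A * Real.exp (e * τ)) ≤ s τ)
    (hXO : ∀ τ ≤ T, X τ * O τ ≤ C2 * Real.exp (e2 * τ)) :
    Tendsto O atBot (𝓝 1) ∧ Tendsto s atBot (𝓝 0) ∧ Tendsto X atBot (𝓝 0) ∧
      Tendsto M atBot (𝓝 0) := by
  have he := h.e0
  have hC := h.C0
  have hv := h.v1
  have hv0 := h.v0
  -- `O` converges
  obtain ⟨o, ho⟩ : ∃ o, Tendsto O atBot (𝓝 o) := by
    have dF : ∀ τ ≤ T, HasDerivAt (fun τ => O τ + 4 * C2 / e2 * Real.exp (e2 * τ))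
        ((2 * (4 * v * O τ + 2 * s τ ^ 2) - 8 * v) * O τ + 4 * C2 * Real.exp (e2 * τ)) τ :=
      fun τ hτ => ((h.dO τ hτ).fun_add (exp_deriv _ _ _)).congr_deriv (by field_simp)
    obtain ⟨l, hl⟩ := conv_of_mono (B := 0) (mono_of_deriv' dF (fun τ hτ => by
      have h1 := hXO τ hτ
      have h2 := h.O0 τ hτ
      have h3 := h.P0 τ hτ
      have h4 := h.X0 τ hτ
      have h5 : (2 * (4 * v * O τ + 2 * s τ ^ 2) - 8 * v) * O τ
        = 4 * (1 - 2 * v) * (s τ ^ 2 * O τ) - 8 * v * (X τ * O τ) + 8 * v * (P τ * O τ) := by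
        linear_combination (8 * v * O τ) * h.con τ hτ
      rw [h5]
      have h6 : 0 ≤ 4 * (1 - 2 * v) * (s τ ^ 2 * O τ) := by
        apply mul_nonneg (by linarith) (by positivity)
      have h7 : 0 ≤ 8 * v * (P τ * O τ) := by positivity
      have h8 : 8 * v * (X τ * O τ) ≤ 4 * (X τ * O τ) :=
        mul_le_mul_of_nonneg_right (by linarith) (by positivity)
      linarith)) (fun τ hτ => by have := h.O0 τ hτ; positivity)
    exact ⟨l, by simpa using hl.sub (exp_tendsto he2 (4 * C2 / e2))⟩
  -- `X` converges
  obtain ⟨x, hx⟩ : ∃ x, Tendsto X atBot (𝓝 x) := by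
    have dF : ∀ τ ≤ T, HasDerivAt (fun τ => - X τ + 4 * C2 / e2 * Real.exp (e2 * τ)
        + 28 * A / e * Real.exp (e * τ))
        (-(2 * ((4 * v * O τ + 2 * s τ ^ 2) - 4 * s τ) * X τ) + 4 * C2 * Real.exp (e2 * τ)
          + 28 * A * Real.exp (e * τ)) τ :=
      fun τ hτ => (((h.dX τ hτ).fun_neg.fun_add (exp_deriv _ _ _)).fun_add
        (exp_deriv _ _ _)).congr_deriv (by field_simp)
    obtain ⟨l, hl⟩ := conv_of_mono (B := -2) (mono_of_deriv' dF (fun τ hτ => by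
      have h1 := hXO τ hτ
      have h2 := h.O0 τ hτ
      have h4 := h.X0 τ hτ
      obtain ⟨-, -, hb1, hb2, hb3⟩ := h.bounds hτ
      have h5 := hs τ hτ
      have h8 : 8 * v * (X τ * O τ) ≤ 4 * (X τ * O τ) :=
        mul_le_mul_of_nonneg_right (by linarith) (by positivity)
      have hE : 0 ≤ A * Real.exp (e * τ) := by positivity
      have h9 : -(28 * (A * Real.exp (e * τ))) ≤ 4 * s τ * ((2 - s τ) * X τ) := by
        have g1 : 0 ≤ (2 - s τ) * X τ := mul_nonneg (by linarith) h4.le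
        have g2 : (2 - s τ) * X τ ≤ 7 := by nlinarith
        nlinarith
      nlinarith)) (fun τ hτ => by
        obtain ⟨-, -, hb1, -, -⟩ := h.bounds hτ
        have g1 : 0 ≤ 4 * C2 / e2 * Real.exp (e2 * τ) := by positivity
        have g2 : 0 ≤ 28 * A / e * Real.exp (e * τ) := by positivity
        linarith)
    refine ⟨-l, ?_⟩
    have := ((hl.sub (exp_tendsto he2 (4 * C2 / e2))).sub (exp_tendsto he (28 * A / e))).neg
    simp only [sub_zero] at this
    exact this.congr (fun τ => by ring)
  -- `s` converges
  have hs2 : Tendsto (fun τ => s τ ^ 2) atBot (𝓝 (1 - o - x)) := by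
    have : Tendsto (fun τ => 1 + P τ - O τ - X τ) atBot (𝓝 (1 + 0 - o - x)) :=
      ((h.Plim.const_add 1).sub ho).sub hx
    rw [add_zero] at this
    refine this.congr' ?_
    filter_upwards [eventually_le_atBot T] with τ hτ
    linarith [h.con τ hτ]
  have habs : Tendsto (fun τ => |s τ|) atBot (𝓝 (Real.sqrt (1 - o - x))) := by
    have := (Real.continuous_sqrt.tendsto (1 - o - x)).comp hs2
    refine this.congr (fun τ => ?_)
    simp [Real.sqrt_sq_eq_abs]
  have hdiff : Tendsto (fun τ => |s τ| - s τ) atBot (𝓝 0) := by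
    refine tendsto_of_tendsto_of_tendsto_of_le_of_le' tendsto_const_nhds
      (exp_tendsto he (2 * A)) ?_ ?_
    · filter_upwards with τ
      linarith [le_abs_self (s τ)]
    · filter_upwards [eventually_le_atBot T] with τ hτ
      have h1 := hs τ hτ
      have hE : 0 ≤ A * Real.exp (e * τ) := by positivity
      rcases abs_cases (s τ) with ⟨h2, _⟩ | ⟨h2, _⟩ <;> rw [h2] <;> linarith
  set σ := Real.sqrt (1 - o - x) with hσ
  have hsσ : Tendsto s atBot (𝓝 σ) := by
    simpa using habs.sub hdiff
  have hσ0 : 0 ≤ σ := Real.sqrt_nonneg _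
  have hσ2 : σ ^ 2 = 1 - o - x := tendsto_nhds_unique (hsσ.pow 2) hs2
  have ho0 : 0 ≤ o := ge_of_tendsto ho (by
    filter_upwards [eventually_le_atBot T] with τ hτ using h.O0 τ hτ)
  have hx0 : 0 ≤ x := ge_of_tendsto hx (by
    filter_upwards [eventually_le_atBot T] with τ hτ using (h.X0 τ hτ).le)
  have hxo : x * o = 0 := by
    apply le_antisymm
    · refine le_of_tendsto_of_tendsto (hx.mul ho) (exp_tendsto he2 C2) ?_
      filter_upwards [eventually_le_atBot T] with τ hτ using hXO τ hτ
    · positivity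
  have hzero : x * (4 - 2 * σ) - (2 - 4 * v) * o * σ - (1 - 2 * σ) * 0 = 0 := by
    refine limit_deriv_zero h.ds' hsσ ?_
    exact ((hx.mul ((hsσ.const_mul 2).const_sub 4)).sub ((ho.const_mul _).mul hsσ)).sub
      (((hsσ.const_mul 2).const_sub 1).mul h.Plim)
  have hσ1 : σ ≤ 1 := by nlinarith
  have hx' : x = 0 := by
    have h1 : x * x * (4 - 2 * σ) = 0 := by
      linear_combination x * hzero + (2 - 4 * v) * σ * hxo
    have h2 : 4 - 2 * σ ≠ 0 := by linarith
    simpa [h2] using h1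
  have hoσ : o * σ = 0 := by
    rw [hx'] at hzero
    have h1 : (2 - 4 * v) * (o * σ) = 0 := by linarith
    have h2 : 2 - 4 * v ≠ 0 := by linarith
    simpa [h2] using h1
  have hσz : σ = 0 := by
    by_contra hne
    have ho' : o = 0 := by simpa [hne] using hoσ
    have hσ1 : σ = 1 := by
      rw [ho', hx'] at hσ2
      nlinarith
    rw [hσ1] at hsσ
    rw [ho'] at ho
    rw [hx'] at hx
    have hco : Tendsto (fun τ => 2 * ((4 * v * O τ + 2 * s τ ^ 2) - 4 * s τ)) atBot
        (𝓝 (2 * ((4 * v * 0 + 2 * 1 ^ 2) - 4 * 1))) :=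
      (((ho.const_mul _).add ((hsσ.pow 2).const_mul 2)).sub (hsσ.const_mul 4)).const_mul 2
    have hev := hco.eventually (gt_mem_nhds (show
      2 * ((4 * v * 0 + 2 * 1 ^ 2) - 4 * 1) < (0:ℝ) by norm_num))
    obtain ⟨S, hS⟩ := eventually_atBot.1 hev
    have hm : MonotoneOn (fun τ => - X τ) (Iic (min S T)) :=
      mono_of_deriv' (fun τ hτ => (h.dX τ (hτ.trans (min_le_right _ _))).fun_neg)
        (fun τ hτ => by
          have h1 := hS τ (hτ.trans (min_le_left _ _))
          have h2 := h.X0 τ (hτ.trans (min_le_right _ _))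
          nlinarith)
    have hX0 := h.X0 _ (min_le_right S T)
    have : X (min S T) ≤ 0 := ge_of_tendsto hx (by
      filter_upwards [eventually_le_atBot (min S T)] with τ hτ
      have := hm hτ (mem_Iic.2 le_rfl) hτ
      simp only at this
      linarith)
    linarith
  have ho1 : o = 1 := by
    rw [hσz, hx'] at hσ2
    linarith
  rw [ho1] at ho
  rw [hσz] at hsσ
  rw [hx'] at hx
  refine ⟨ho, hsσ, hx, ?_⟩
  have dlM : ∀ τ ≤ T, HasDerivAt (fun τ => Real.log (M τ))
      ((4 * v * O τ + 2 * s τ ^ 2) + 2 * s τ) τ := by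
    intro τ hτ
    have hM := h.M0 τ hτ
    exact ((h.dM τ hτ).log hM.ne').congr_deriv (by field_simp)
  have hco : Tendsto (fun τ => (4 * v * O τ + 2 * s τ ^ 2) + 2 * s τ) atBot
      (𝓝 ((4 * v * 1 + 2 * 0 ^ 2) + 2 * 0)) :=
    ((ho.const_mul _).add ((hsσ.pow 2).const_mul 2)).add (hsσ.const_mul 2)
  have hev := hco.eventually (lt_mem_nhds (show
      v < (4 * v * 1 + 2 * 0 ^ 2) + 2 * 0 by linarith))
  obtain ⟨S, hS⟩ := eventually_atBot.1 hev
  have hlog := tendsto_atBot_of_grow (T := min S T) hv0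
    (fun τ hτ => dlM τ (hτ.trans (min_le_right _ _)))
    (fun τ hτ => (hS τ (hτ.trans (min_le_left _ _))).le)
  refine (Real.tendsto_exp_atBot.comp hlog).congr' ?_
  filter_upwards [eventually_le_atBot T] with τ hτ
  exact Real.exp_log (h.M0 τ hτ)

set_option maxHeartbeats 1600000 in
/-- The Lyapunov function argument: either convergence to `P₁⁺(II)`, or `XΩ` decays
exponentially. -/
lemma Red2.lyap (h : Red2 v T e C s X O P M) (hOpos : ∀ τ ≤ T, 0 < O τ) :
    (Tendsto s atBot (𝓝 v) ∧ Tendsto O atBot (𝓝 (1 - v / 2))) ∨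
    ∃ T2 ≤ T, ∃ e2 C2 : ℝ, 0 < e2 ∧ 0 ≤ C2 ∧
      ∀ τ ≤ T2, X τ * O τ ≤ C2 * Real.exp (e2 * τ) := by
  have he := h.e0
  have hC := h.C0
  have hv := h.v1
  have hv0 := h.v0
  have hv2 : 0 < 1 - v ^ 2 := by nlinarith
  obtain ⟨c, hcdef⟩ : ∃ c, c = 2 * (1 - 2 * v) / (1 - v ^ 2) := ⟨_, rfl⟩
  have hc : c * (1 - v ^ 2) = 2 - 4 * v := by
    rw [hcdef]; field_simp; ring
  have hc0 : 0 < c := by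
    rw [hcdef]; apply div_pos _ hv2; linarith
  obtain ⟨a, ha⟩ : ∃ a, a = c * v / 4 := ⟨_, rfl⟩
  have ha0 : 0 < a := by rw [ha]; positivity
  have ha1 : a < 1 := by
    have : c < 4 := by
      by_contra hcon
      push Not at hcon
      nlinarith
    rw [ha]; nlinarith
  set κ := c / 600 with hκ
  have hκ0 : 0 < κ := by positivity
  have hD : ∀ τ ≤ T, 1 / 4 ≤ 1 - v * s τ ∧ 1 - v * s τ ≤ 2 := by
    intro τ hτ
    obtain ⟨-, -, -, hb2, hb3⟩ := h.bounds hτ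
    constructor <;> nlinarith
  -- the derivative of the main part
  set ds : ℝ → ℝ := fun τ => -(2 - (4 * v * O τ + 2 * s τ ^ 2)) * s τ + 4 * X τ - P τ with hds
  set dO : ℝ → ℝ := fun τ => (2 * (4 * v * O τ + 2 * s τ ^ 2) - 8 * v) * O τ with hdO
  set L : ℝ → ℝ := fun τ => a * Real.log (X τ) + (1 - a) * Real.log (O τ)
    - 2 * Real.log (1 - v * s τ) with hL
  set dL : ℝ → ℝ := fun τ => a * (2 * ((4 * v * O τ + 2 * s τ ^ 2) - 4 * s τ)) +
    (1 - a) * (2 * (4 * v * O τ + 2 * s τ ^ 2) - 8 * v) + 2 * v * ds τ / (1 - v * s τ) with hdL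
  have hLd : ∀ τ ≤ T, HasDerivAt L (dL τ) τ := by
    intro τ hτ
    have h1 := h.X0 τ hτ
    have h2 := hOpos τ hτ
    have h3 : 0 < 1 - v * s τ := by linarith [(hD τ hτ).1]
    have := ((((h.dX τ hτ).log h1.ne').const_mul a).fun_add
      (((h.dO τ hτ).log h2.ne').const_mul (1 - a))).fun_sub
      (((((h.ds τ hτ).const_mul v).const_sub 1).log h3.ne').const_mul 2)
    refine this.congr_deriv ?_
    simp only [hdL, hds]
    field_simp
    ring
  have hLlow : ∀ τ ≤ T, c * (s τ - v) ^ 2 ≤ dL τ := by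
    intro τ hτ
    obtain ⟨hD1, hD2⟩ := hD τ hτ
    have h3 : 0 < 1 - v * s τ := by linarith
    have hP := h.P0 τ hτ
    have hid : dL τ * (1 - v * s τ) = 2 * c * (s τ - v) ^ 2 + 6 * v * P τ := by
      have : dL τ * (1 - v * s τ) = (a * (2 * ((4 * v * O τ + 2 * s τ ^ 2) - 4 * s τ)) +
        (1 - a) * (2 * (4 * v * O τ + 2 * s τ ^ 2) - 8 * v)) * (1 - v * s τ)
          + 2 * v * ds τ := by
        simp only [hdL]
        field_simp
      rw [this, ha]
      simp only [hds]
      linear_combination (8 * v) * h.con τ hτ - 2 * (s τ ^ 2 - v * s τ) * hc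
    have h4 : 0 ≤ c * (s τ - v) ^ 2 := by positivity
    have h5 : 0 < 6 * v * P τ := by positivity
    have h6 := mul_le_mul_of_nonneg_left hD2 h4
    refine le_of_mul_le_mul_right ?_ h3
    rw [hid]
    linarith
  -- the mixed term
  have hds' : ∀ τ ≤ T, ds τ = (O τ - (1 - v / 2)) * (4 * v * s τ - 4)
      + (s τ - v) * (-2 - 4 * s τ + 2 * s τ ^ 2 + 2 * s τ * v) + 3 * P τ := by
    intro τ hτ
    simp only [hds]
    linear_combination 4 * h.con τ hτ
  have hdO' : ∀ τ ≤ T, dO τ = O τ * (4 * (s τ - v) ^ 2 + 8 * v * (s τ - v)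
      + 8 * v * (O τ - (1 - v / 2))) := by
    intro τ hτ
    simp only [hdO]
    ring
  have hu : ∀ τ ≤ T, |s τ - v| ≤ 2 := by
    intro τ hτ
    obtain ⟨-, -, -, hb2, hb3⟩ := h.bounds hτ
    rw [abs_le]; constructor <;> linarith
  have hw : ∀ τ ≤ T, |O τ - (1 - v / 2)| ≤ 2 := by
    intro τ hτ
    obtain ⟨-, hb2, -, -, -⟩ := h.bounds hτ
    have := h.O0 τ hτ
    rw [abs_le]; constructor <;> linarith
  have hp0 : ∀ τ ≤ T, |-2 - 4 * s τ + 2 * s τ ^ 2 + 2 * s τ * v| ≤ 14 := by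
    intro τ hτ
    obtain ⟨hb1, -, -, hb2, hb3⟩ := h.bounds hτ
    rw [abs_le]; constructor <;> nlinarith [sq_nonneg (s τ)]
  have hmix : ∀ τ ≤ T, (O τ - (1 - v / 2)) ^ 2 / 2 - 300 * (s τ - v) ^ 2 - 6 * P τ ≤
      -(ds τ * (O τ - (1 - v / 2)) + (s τ - v) * dO τ) := by
    intro τ hτ
    rw [hds' τ hτ, hdO' τ hτ]
    have k1 := hu τ hτ
    have k2 := hw τ hτ
    have k3 := hp0 τ hτ
    obtain ⟨hD1, -⟩ := hD τ hτ
    obtain ⟨-, hO2, -, -, -⟩ := h.bounds hτ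
    have hO := h.O0 τ hτ
    have hP := h.P0 τ hτ
    set u := s τ - v
    set w := O τ - (1 - v / 2)
    set p := -2 - 4 * s τ + 2 * s τ ^ 2 + 2 * s τ * v
    have e1 : w ^ 2 ≤ w ^ 2 * (4 * (1 - v * s τ)) := by nlinarith [sq_nonneg w]
    have e2 : u * w * p ≤ 14 * (|u| * |w|) := by
      calc u * w * p ≤ |u * w * p| := le_abs_self _
        _ = |p| * (|u| * |w|) := by rw [abs_mul, abs_mul]; ring
        _ ≤ _ := by gcongr
    have e3 : u * w * (8 * v * O τ) ≤ 8 * (|u| * |w|) := by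
      calc u * w * (8 * v * O τ) ≤ |u * w * (8 * v * O τ)| := le_abs_self _
        _ = (8 * v * O τ) * (|u| * |w|) := by
          rw [abs_mul, abs_mul, abs_of_nonneg (by positivity : 0 ≤ 8 * v * O τ)]; ring
        _ ≤ _ := by
          apply mul_le_mul_of_nonneg_right _ (by positivity)
          nlinarith
    have e4 : P τ * w ≤ 2 * P τ := by
      have := (abs_le.1 k2).2
      nlinarith
    have e5 : u ^ 2 * (O τ * (4 * u + 8 * v)) ≤ u ^ 2 * 24 := by
      apply mul_le_mul_of_nonneg_left _ (sq_nonneg u)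
      have k4 := (abs_le.1 k1).2
      have : 4 * u + 8 * v ≤ 12 := by linarith
      calc O τ * (4 * u + 8 * v) ≤ O τ * 12 := by gcongr
        _ ≤ 2 * 12 := by gcongr
        _ = 24 := by norm_num
    have e6 : 22 * (|u| * |w|) ≤ w ^ 2 / 2 + 242 * u ^ 2 := by
      rw [← sq_abs w, ← sq_abs u]
      nlinarith [sq_nonneg (|w| - 22 * |u|)]
    have e7 : -((w * (4 * v * s τ - 4) + u * p + 3 * P τ) * w +
        u * (O τ * (4 * u ^ 2 + 8 * v * u + 8 * v * w))) =
        w ^ 2 * (4 * (1 - v * s τ)) - u * w * p - 3 * (P τ * w)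
          - u ^ 2 * (O τ * (4 * u + 8 * v)) - u * w * (8 * v * O τ) := by ring
    rw [e7]
    linarith [sq_nonneg u]
  -- the Lyapunov function
  set H : ℝ → ℝ := fun τ => L τ + κ * (-((s τ - v) * (O τ - (1 - v / 2))))
    + 6 * κ * C / e * Real.exp (e * τ) with hH
  set dH : ℝ → ℝ := fun τ => dL τ + κ * (-(ds τ * (O τ - (1 - v / 2)) + (s τ - v) * dO τ))
    + 6 * κ * C * Real.exp (e * τ) with hdH
  have hHd : ∀ τ ≤ T, HasDerivAt H (dH τ) τ := by
    intro τ hτ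
    have := ((hLd τ hτ).fun_add (((((h.ds τ hτ).sub_const v).fun_mul
      ((h.dO τ hτ).sub_const (1 - v / 2))).fun_neg).const_mul κ)).fun_add
      (exp_deriv (6 * κ * C / e) e τ)
    refine this.congr_deriv ?_
    simp only [hdH, hds, hdO]
    field_simp
  have hHlow : ∀ τ ≤ T, κ / 2 * ((s τ - v) ^ 2 + (O τ - (1 - v / 2)) ^ 2) ≤ dH τ := by
    intro τ hτ
    have h1 := hLlow τ hτ
    have h2 := mul_le_mul_of_nonneg_left (hmix τ hτ) hκ0.le
    have h3 := mul_le_mul_of_nonneg_left (h.Pe τ hτ) (by positivity : 0 ≤ 6 * κ)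
    have h4 : c = 600 * κ := by rw [hκ]; ring
    rw [h4] at h1
    simp only [hdH]
    linarith [mul_nonneg hκ0.le (sq_nonneg (s τ - v))]
  have hHmono : MonotoneOn H (Iic T) := mono_of_deriv' hHd (fun τ hτ =>
    (by positivity : 0 ≤ κ / 2 * ((s τ - v) ^ 2 + (O τ - (1 - v / 2)) ^ 2)).trans (hHlow τ hτ))
  by_cases hbd : ∃ B, ∀ τ ≤ T, B ≤ H τ
  · left
    obtain ⟨B, hB⟩ := hbd
    have hu0 : Tendsto (fun τ => s τ - v) atBot (𝓝 0) := by
      refine barbalat (c := κ / 2) (K := 45) (by positivity)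
        (fun τ hτ => (h.ds τ hτ).sub_const v) hHd ?_ ?_ hB
      · intro τ hτ
        have hh := hds' τ hτ
        simp only [hds] at hh
        rw [hh]
        have k1 := hu τ hτ
        have k2 := hw τ hτ
        have k3 := hp0 τ hτ
        have k4 : |4 * v * s τ - 4| ≤ 7 := by
          obtain ⟨-, -, -, hb2, hb3⟩ := h.bounds hτ
          rw [abs_le]; constructor <;> nlinarith
        have k5 : |3 * P τ| ≤ 3 := by
          have := h.P0 τ hτ
          have := h.P1 τ hτ
          rw [abs_le]; constructor <;> linarith
        refine (abs_add_three _ _ _).trans ?_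
        rw [abs_mul, abs_mul]
        have k6 := mul_le_mul k2 k4 (abs_nonneg _) (by norm_num)
        have k7 := mul_le_mul k1 k3 (abs_nonneg _) (by norm_num)
        linarith
      · intro τ hτ
        have := hHlow τ hτ
        nlinarith [mul_nonneg hκ0.le (sq_nonneg (O τ - (1 - v / 2)))]
    have hw0 : Tendsto (fun τ => O τ - (1 - v / 2)) atBot (𝓝 0) := by
      refine barbalat (c := κ / 2) (K := 64) (by positivity)
        (fun τ hτ => (h.dO τ hτ).sub_const (1 - v / 2)) hHd ?_ ?_ hB
      · intro τ hτ
        obtain ⟨hb1, hb4, -, hb2, hb3⟩ := h.bounds hτ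
        have hO := h.O0 τ hτ
        rw [abs_mul, abs_of_nonneg hO]
        have k1 : |2 * (4 * v * O τ + 2 * s τ ^ 2) - 8 * v| ≤ 20 := by
          rw [abs_le]
          have : v * O τ ≤ 1 / 2 * 2 := by gcongr
          have : 0 ≤ v * O τ := by positivity
          have := sq_nonneg (s τ)
          constructor <;> linarith
        have := mul_le_mul k1 hb4 hO (by norm_num)
        linarith
      · intro τ hτ
        have := hHlow τ hτ
        nlinarith [mul_nonneg hκ0.le (sq_nonneg (s τ - v))]
    refine ⟨?_, ?_⟩
    · simpa using hu0.add_const v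
    · have := hw0.add_const (1 - v / 2)
      simp only [zero_add] at this
      exact this.congr (fun τ => by ring)
  · right
    push Not at hbd
    have hlogXO : ∀ τ ≤ T, Real.log (X τ * O τ) ≤ H τ + (4 * κ + 3) := by
      intro τ hτ
      have h1 := h.X0 τ hτ
      have h2 := hOpos τ hτ
      obtain ⟨hD1, hD2⟩ := hD τ hτ
      obtain ⟨-, hO2, hX2, -, -⟩ := h.bounds hτ
      have l2 : Real.log 2 ≤ 1 := by
        have := Real.log_le_sub_one_of_pos (show (0:ℝ) < 2 by norm_num)
        linarith
      have g1 : Real.log (X τ) ≤ Real.log 2 := Real.log_le_log h1 hX2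
      have g2 : Real.log (O τ) ≤ Real.log 2 := Real.log_le_log h2 hO2
      have g3 : Real.log (1 - v * s τ) ≤ Real.log 2 := Real.log_le_log (by linarith) hD2
      have g4 : (s τ - v) * (O τ - (1 - v / 2)) ≤ 4 := by
        calc (s τ - v) * (O τ - (1 - v / 2)) ≤ |(s τ - v) * (O τ - (1 - v / 2))| := le_abs_self _
          _ = |s τ - v| * |O τ - (1 - v / 2)| := abs_mul _ _
          _ ≤ 2 * 2 := mul_le_mul (hu τ hτ) (hw τ hτ) (abs_nonneg _) (by norm_num)
          _ = 4 := by norm_num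
      have g5 : 0 < 6 * κ * C / e * Real.exp (e * τ) := by positivity
      have g6 := mul_le_mul_of_nonneg_left g4 hκ0.le
      rw [Real.log_mul h1.ne' h2.ne']
      simp only [hH, hL]
      have g7 : 0 ≤ (1 - a) * (Real.log 2 - Real.log (X τ)) :=
        mul_nonneg (by linarith) (by linarith)
      have g8 : 0 ≤ a * (Real.log 2 - Real.log (O τ)) := mul_nonneg ha0.le (by linarith)
      linarith
    set θ := (v / 2 - v ^ 2) * (1 - v / 2) with hθ
    have hθ0 : 0 < θ := by
      apply mul_pos
      · nlinarith
      · linarith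
    obtain ⟨τ₀, hτ₀, hlt⟩ := hbd (Real.log (θ / 4) - (4 * κ + 3))
    obtain ⟨S, hS⟩ := eventually_atBot.1
      (h.Plim.eventually (gt_mem_nhds (show 0 < θ / 12 by positivity)))
    set T2 := min τ₀ S with hT2
    have hT2T : T2 ≤ T := (min_le_left _ _).trans hτ₀
    have hsep : ∀ τ ≤ T2, κ * θ ^ 2 / 144 ≤ dH τ := by
      intro τ hτ
      have hτT := hτ.trans hT2T
      have hPs := hS τ (hτ.trans (min_le_right _ _))
      have h1 := h.X0 τ hτT
      have h2 := hOpos τ hτT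
      have hHs : H τ ≤ H τ₀ := hHmono hτT hτ₀ (hτ.trans (min_le_left _ _))
      have hxo : X τ * O τ ≤ θ / 4 := by
        refine (Real.log_le_log_iff (by positivity) (by positivity)).1 ?_
        linarith [hlogXO τ hτT]
      obtain ⟨-, hO2, hX2, hb2, hb3⟩ := h.bounds hτT
      have hP := h.P0 τ hτT
      have hid : X τ * O τ - θ = X τ * (O τ - (1 - v / 2)) + (1 - v / 2) * (P τ
          - (O τ - (1 - v / 2)) - (s τ - v) * (s τ + v)) := by
        rw [hθ]
        linear_combination (1 - v / 2) * h.con τ hτT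
      have g1 : -(2 * |O τ - (1 - v / 2)|) ≤ X τ * (O τ - (1 - v / 2)) := by
        have := neg_abs_le (O τ - (1 - v / 2))
        nlinarith [abs_nonneg (O τ - (1 - v / 2))]
      have g2 : (s τ - v) * (s τ + v) ≤ |s τ - v| * 2 := by
        calc (s τ - v) * (s τ + v) ≤ |(s τ - v) * (s τ + v)| := le_abs_self _
          _ = |s τ - v| * |s τ + v| := abs_mul _ _
          _ ≤ |s τ - v| * 2 := by
            gcongr
            rw [abs_le]; constructor <;> linarith
      have g3 : -(|O τ - (1 - v / 2)| + |s τ - v| * 2) ≤ (1 - v / 2) * (P τ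
          - (O τ - (1 - v / 2)) - (s τ - v) * (s τ + v)) := by
        have k1 := le_abs_self (O τ - (1 - v / 2))
        have k2 : 0 ≤ |O τ - (1 - v / 2)| + |s τ - v| * 2 := by positivity
        have k3 : -(|O τ - (1 - v / 2)| + |s τ - v| * 2) ≤ P τ
          - (O τ - (1 - v / 2)) - (s τ - v) * (s τ + v) := by linarith
        nlinarith
      have g4 : θ / 6 ≤ |s τ - v| + |O τ - (1 - v / 2)| := by
        have := abs_nonneg (s τ - v)
        linarith
      have g5 : θ ^ 2 / 72 ≤ (s τ - v) ^ 2 + (O τ - (1 - v / 2)) ^ 2 := by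
        rw [← sq_abs (s τ - v), ← sq_abs (O τ - (1 - v / 2))]
        nlinarith [sq_nonneg (|s τ - v| - |O τ - (1 - v / 2)|)]
      have g6 := hHlow τ hτT
      have g7 := mul_le_mul_of_nonneg_left g5 (by positivity : 0 ≤ κ / 2)
      linarith
    have hgrow := grow_of_deriv (fun τ hτ => hHd τ (hτ.trans hT2T)) hsep
    refine ⟨T2, hT2T, κ * θ ^ 2 / 144,
      Real.exp (H T2 - κ * θ ^ 2 / 144 * T2 + (4 * κ + 3)), by positivity,
      (Real.exp_pos _).le, ?_⟩
    intro τ hτ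
    have h1 := h.X0 τ (hτ.trans hT2T)
    have h2 := hOpos τ (hτ.trans hT2T)
    rw [← Real.exp_add, ← Real.exp_log (mul_pos h1 h2)]
    apply Real.exp_le_exp.2
    have := hlogXO τ (hτ.trans hT2T)
    have := hgrow τ hτ
    linarith

/-- `Ω` is either positive or vanishes towards the past. -/
lemma Red2.O_alt (h : Red2 v T e C s X O P M) :
    (∀ τ ≤ T, 0 < O τ) ∨ ∃ T2 ≤ T, ∀ τ ≤ T2, O τ = 0 := by
  by_cases hpos : ∀ τ ≤ T, 0 < O τ
  · exact Or.inl hpos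
  right
  push Not at hpos
  obtain ⟨τ₀, h0, hle⟩ := hpos
  refine ⟨τ₀, h0, ?_⟩
  have hv := h.v1
  have hv0 := h.v0
  have hm : MonotoneOn (fun τ => O τ * (1 * Real.exp (4 * τ))) (Iic T) :=
    mono_of_deriv' (fun τ hτ => (h.dO τ hτ).fun_mul (exp_deriv 1 4 τ)) (fun τ hτ => by
      have hO := h.O0 τ hτ
      have hE := Real.exp_pos (4 * τ)
      have h2 : (2 * (4 * v * O τ + 2 * s τ ^ 2) - 8 * v) * O τ * (1 * Real.exp (4 * τ)) +
          O τ * (1 * 4 * Real.exp (4 * τ)) = (8 * v * O τ + 4 * s τ ^ 2 + (4 - 8 * v)) *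
            (O τ * Real.exp (4 * τ)) := by ring
      rw [h2]
      have : 0 ≤ 4 - 8 * v := by linarith
      positivity)
  intro τ hτ
  have h1 := hm (mem_Iic.2 (hτ.trans h0)) (mem_Iic.2 h0) hτ
  simp only [one_mul] at h1
  have h2 := h.O0 τ (hτ.trans h0)
  have hE := Real.exp_pos (4 * τ)
  have hE0 := Real.exp_pos (4 * τ₀)
  have h3 : O τ₀ * Real.exp (4 * τ₀) ≤ 0 := mul_nonpos_of_nonpos_of_nonneg hle hE0.le
  nlinarith

/-- The trichotomy for the reduced system. -/
lemma Red2.main (h : Red2 v T e C s X O P M) :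
    (Tendsto O atBot (𝓝 1) ∧ Tendsto s atBot (𝓝 0) ∧ Tendsto X atBot (𝓝 0) ∧
      Tendsto M atBot (𝓝 0)) ∨
    (Tendsto s atBot (𝓝 v) ∧ Tendsto O atBot (𝓝 (1 - v / 2))) ∨
    (Tendsto O atBot (𝓝 0) ∧ Tendsto s atBot (𝓝 (-1)) ∧ Tendsto X atBot (𝓝 0) ∧
      ∃ c, 0 < c ∧ Tendsto M atBot (𝓝 c)) := by
  have he := h.e0
  have hC := h.C0
  by_cases htrap : ∃ τ₀ ≤ T, s τ₀ + 5 * C / e * Real.exp (e * τ₀) < 0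
  · right; right
    obtain ⟨τ₀, h0, hneg⟩ := htrap
    refine (h.mono2 h0).caseA (m := -(s τ₀ + 5 * C / e * Real.exp (e * τ₀))) (by linarith) ?_
    intro τ hτ
    have h1 := h.trap h0 hneg τ hτ
    have h2 : 0 < 5 * C / e * Real.exp (e * τ) := by positivity
    linarith
  push Not at htrap
  have hB : ∀ T2 ≤ T, ∀ e2 C2 : ℝ, 0 < e2 → 0 ≤ C2 →
      (∀ τ ≤ T2, X τ * O τ ≤ C2 * Real.exp (e2 * τ)) →
      (Tendsto O atBot (𝓝 1) ∧ Tendsto s atBot (𝓝 0) ∧ Tendsto X atBot (𝓝 0) ∧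
      Tendsto M atBot (𝓝 0)) := by
    intro T2 hT2 e2 C2 he2 hC2 hXO
    refine (h.mono2 hT2).caseB (A := 5 * C / e) (by positivity) he2 hC2 ?_ hXO
    intro τ hτ
    have := htrap τ (hτ.trans hT2)
    linarith
  rcases h.O_alt with hpos | ⟨T2, hT2, hz⟩
  · rcases h.lyap hpos with hP1 | ⟨T2, hT2, e2, C2, he2, hC2, hXO⟩
    · exact Or.inr (Or.inl hP1)
    · exact Or.inl (hB T2 hT2 e2 C2 he2 hC2 hXO)
  · left
    refine hB T2 hT2 1 0 one_pos le_rfl ?_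
    intro τ hτ
    rw [hz τ hτ]
    simp

end red2

lemma Red.toRed2 {v : ℝ} {s X O P M : ℝ → ℝ} (h : Red v 0 s X O P M) :
    ∃ T e C : ℝ, T ≤ 0 ∧ Red2 v T e C s X O P M := by
  obtain ⟨e, C, he, hC, hP⟩ := h.decay
  obtain ⟨S, hS⟩ := eventually_atBot.1
    ((exp_tendsto he C).eventually (gt_mem_nhds (show (0:ℝ) < 1 by norm_num)))
  exact ⟨min S 0, e, C, min_le_right _ _, h.mono (min_le_right _ _), he, hC,
    fun τ hτ => (hP τ (hτ.trans (min_le_right _ _))).trans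
      (hS τ (hτ.trans (min_le_left _ _))).le,
    fun τ hτ => hP τ (hτ.trans (min_le_right _ _))⟩

/-- At least one of the three alternatives holds. -/
lemma taub_trichotomy
    (γ : ℝ) (hγ1 : 2/3 < γ) (hγ2 : γ < 2)
    (O Sp Sm n1 n2 n3 : ℝ → ℝ)
    (hsol : SolOn γ (Set.Iic 0) O Sp Sm n1 n2 n3)
    (hIX : ∀ τ ∈ Set.Iic (0:ℝ), 0 < n1 τ ∧ 0 < n2 τ ∧ 0 < n3 τ)
    (hSm0 : ∀ τ ∈ Set.Iic (0:ℝ), Sm τ = 0)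
    (htaub : ∀ τ ∈ Set.Iic (0:ℝ), n2 τ = n3 τ) :
    TendstoF O Sp Sm n1 n2 n3 ∨ TendstoP1 γ O Sp Sm n1 n2 n3 ∨
      TaubLimit O Sp Sm n1 n2 n3 := by
  have hred : Red ((3 * γ - 2) / 8) 0 Sp (fun τ => 3 / 4 * n1 τ ^ 2) O
      (fun τ => 3 * (n1 τ * n2 τ)) n2 := by
    refine ⟨by linarith, by linarith, ?_, ?_, ?_, ?_, ?_, ?_, ?_, ?_, ?_, ?_⟩
    · intro τ hτ
      refine (hsol.hSp τ hτ).congr_deriv ?_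
      rw [hSm0 τ hτ, ← htaub τ hτ]
      simp only [qf, SPf]
      ring
    · intro τ hτ
      refine (((hsol.hn1 τ hτ).fun_pow 2).const_mul (3 / 4)).congr_deriv ?_
      rw [hSm0 τ hτ]
      simp only [qf]
      norm_num
      ring
    · intro τ hτ
      refine (hsol.hO τ hτ).congr_deriv ?_
      rw [hSm0 τ hτ]
      simp only [qf]
      ring
    · intro τ hτ
      refine (((hsol.hn1 τ hτ).fun_mul (hsol.hn2 τ hτ)).const_mul 3).congr_deriv ?_
      rw [hSm0 τ hτ]
      simp only [qf]
      ring
    · intro τ hτ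
      refine (hsol.hn2 τ hτ).congr_deriv ?_
      rw [hSm0 τ hτ]
      simp only [qf]
      ring
    · intro τ hτ
      have := (hIX τ hτ).1
      positivity
    · intro τ hτ
      have h1 := (hIX τ hτ).1
      have h2 := (hIX τ hτ).2.1
      positivity
    · intro τ hτ
      exact (hIX τ hτ).2.1
    · intro τ hτ
      exact hsol.hOnn τ hτ
    · intro τ hτ
      have h1 := hsol.hcon τ hτ
      rw [Constraint, hSm0 τ hτ, ← htaub τ hτ] at h1
      linarith
  obtain ⟨T, e, C, hT, h2⟩ := hred.toRed2
  have hSm : Tendsto Sm atBot (𝓝 0) := by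
    refine tendsto_const_nhds.congr' ?_
    filter_upwards [eventually_le_atBot 0] with τ hτ using (hSm0 τ hτ).symm
  have hn3 : ∀ l, Tendsto n2 atBot (𝓝 l) → Tendsto n3 atBot (𝓝 l) := by
    intro l hl
    refine hl.congr' ?_
    filter_upwards [eventually_le_atBot 0] with τ hτ using htaub τ hτ
  have hn1 : ∀ l, Tendsto (fun τ => 3 / 4 * n1 τ ^ 2) atBot (𝓝 l) →
      Tendsto n1 atBot (𝓝 (Real.sqrt (4 / 3 * l))) := by
    intro l hl
    refine ((Real.continuous_sqrt.tendsto _).comp (hl.const_mul (4 / 3))).congr' ?_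
    filter_upwards [eventually_le_atBot 0] with τ hτ
    have h3 : 4 / 3 * (3 / 4 * n1 τ ^ 2) = n1 τ ^ 2 := by ring
    simp only [Function.comp, h3]
    exact Real.sqrt_sq (hIX τ hτ).1.le
  rcases h2.main with ⟨hO, hs, hX, hM⟩ | ⟨hs, hO⟩ | ⟨hO, hs, hX, c, hc, hM⟩
  · left
    refine ⟨hO, hs, hSm, ?_, hM, hn3 0 hM⟩
    simpa using hn1 0 hX
  · right; left
    set v := (3 * γ - 2) / 8 with hv
    have hv0 : 0 < v := by rw [hv]; linarith
    have hv1 : v < 1 / 2 := by rw [hv]; linarith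
    have hX : Tendsto (fun τ => 3 / 4 * n1 τ ^ 2) atBot (𝓝 (1 + 0 - (1 - v / 2) - v ^ 2)) := by
      refine (((h2.Plim.const_add 1).sub hO).sub (hs.pow 2)).congr' ?_
      filter_upwards [eventually_le_atBot T] with τ hτ
      have := h2.con τ hτ
      linarith
    have hn := hn1 _ hX
    have hcpos : 0 < Real.sqrt (4 / 3 * (1 + 0 - (1 - v / 2) - v ^ 2)) := by
      apply Real.sqrt_pos.2
      nlinarith
    have hM : Tendsto n2 atBot (𝓝 0) := by
      have := h2.Plim.div (hn.const_mul 3) (by positivity)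
      rw [zero_div] at this
      refine this.congr' ?_
      filter_upwards [eventually_le_atBot 0] with τ hτ
      have h1 := (hIX τ hτ).1
      simp only [Pi.div_apply]
      field_simp
    refine ⟨?_, hs, hSm, ⟨_, hcpos, hn⟩, hM, hn3 0 hM⟩
    convert hO using 2
    rw [hv]; ring
  · right; right
    refine ⟨hO, hs, hSm, ?_, c, hc, hM, hn3 c hM⟩
    simpa using hn1 0 hX

/-- a Taub type Bianchi IX solution (`Σ₋ ≡ 0`, `N₂ ≡ N₃`) with
`2/3 < γ < 2` satisfies exactly one of: it converges to `F`; it converges to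
`P₁⁺(II)`; or it converges to `(0, -1, 0, 0, n₂, n₂)` with `0 < n₂ < ∞`. -/
theorem taubIX_asymptotics
    (γ : ℝ) (hγ1 : 2/3 < γ) (hγ2 : γ < 2)
    (O Sp Sm n1 n2 n3 : ℝ → ℝ)
    (hsol : SolOn γ (Set.Iic 0) O Sp Sm n1 n2 n3)
    (hIX : ∀ τ ∈ Set.Iic (0:ℝ), 0 < n1 τ ∧ 0 < n2 τ ∧ 0 < n3 τ)
    (hSm0 : ∀ τ ∈ Set.Iic (0:ℝ), Sm τ = 0)
    (htaub : ∀ τ ∈ Set.Iic (0:ℝ), n2 τ = n3 τ) :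
    (TendstoF O Sp Sm n1 n2 n3 ∧ ¬ TendstoP1 γ O Sp Sm n1 n2 n3 ∧
      ¬ TaubLimit O Sp Sm n1 n2 n3) ∨
    (¬ TendstoF O Sp Sm n1 n2 n3 ∧ TendstoP1 γ O Sp Sm n1 n2 n3 ∧
      ¬ TaubLimit O Sp Sm n1 n2 n3) ∨
    (¬ TendstoF O Sp Sm n1 n2 n3 ∧ ¬ TendstoP1 γ O Sp Sm n1 n2 n3 ∧
      TaubLimit O Sp Sm n1 n2 n3) := by
  have key := taub_trichotomy γ hγ1 hγ2 O Sp Sm n1 n2 n3 hsol hIX hSm0 htaub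
  have x1 : ¬ (TendstoF O Sp Sm n1 n2 n3 ∧ TendstoP1 γ O Sp Sm n1 n2 n3) := by
    rintro ⟨h1, h2⟩
    have := tendsto_nhds_unique h1.1 h2.1
    linarith
  have x2 : ¬ (TendstoF O Sp Sm n1 n2 n3 ∧ TaubLimit O Sp Sm n1 n2 n3) := by
    rintro ⟨h1, h2⟩
    have := tendsto_nhds_unique h1.1 h2.1
    linarith
  have x3 : ¬ (TendstoP1 γ O Sp Sm n1 n2 n3 ∧ TaubLimit O Sp Sm n1 n2 n3) := by
    rintro ⟨h1, h2⟩
    have := tendsto_nhds_unique h1.1 h2.1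
    linarith
  tauto

end WainwrightHsu
end
end

section
/- Let 2/3 < γ < 2. For every ε > 0 there exists δ > 0 such that: if x₀ ∈ ℝ⁶ is Bianchi type IX initial data for the Wainwright–Hsu system (satisfying the constraint, Ω ≥ 0 and all Nᵢ > 0) whose Euclidean distance to the Bianchi attractor 𝒜 is at most δ, then the solution Φ(τ, x₀) through x₀ satisfies inf_{y ∈ 𝒜} ‖Φ(τ, x₀) − y‖ ≤ ε for all τ ≤ 0. -/
open Real Filter Topology Set

noncomputable section

namespace WainwrightHsu

/-- Symmetric curvature term. -/
def Sc (a b c : ℝ) : ℝ := (1/2) * ((b - c)^2 - a * (2*a - b - c))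

/-- Time-reversed, symmetric form of the system; `Q = 2 - q`. -/
structure Sys (γ : ℝ) (Q s1 s2 s3 a b c O : ℝ → ℝ) : Prop where
  da : ∀ t, 0 ≤ t → HasDerivAt a ((4 * s1 t - 2 + Q t) * a t) t
  db : ∀ t, 0 ≤ t → HasDerivAt b ((4 * s2 t - 2 + Q t) * b t) t
  dc : ∀ t, 0 ≤ t → HasDerivAt c ((4 * s3 t - 2 + Q t) * c t) t
  ds1 : ∀ t, 0 ≤ t → HasDerivAt s1 (Q t * s1 t + 3 * Sc (a t) (b t) (c t)) t
  ds2 : ∀ t, 0 ≤ t → HasDerivAt s2 (Q t * s2 t + 3 * Sc (b t) (c t) (a t)) t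
  ds3 : ∀ t, 0 ≤ t → HasDerivAt s3 (Q t * s3 t + 3 * Sc (c t) (a t) (b t)) t
  dO : ∀ t, 0 ≤ t → HasDerivAt O ((-(6 - 3*γ) + 2 * Q t) * O t) t
  hQ : ∀ t, 0 ≤ t → Q t = (3/2) * ((a t)^2 + (b t)^2 + (c t)^2
      - 2 * (a t * b t + b t * c t + c t * a t)) + (3/2) * (2 - γ) * O t
  hO : ∀ t, 0 ≤ t → 0 ≤ O t
  ha : ∀ t, 0 ≤ t → 0 < a t
  hb : ∀ t, 0 ≤ t → 0 < b t
  hc : ∀ t, 0 ≤ t → 0 < c t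
  hs : ∀ t, 0 ≤ t → s1 t + s2 t + s3 t = 0
  hcon : ∀ t, 0 ≤ t → O t + (2/3) * ((s1 t)^2 + (s2 t)^2 + (s3 t)^2)
      + (3/4) * ((a t)^2 + (b t)^2 + (c t)^2
      - 2 * (a t * b t + b t * c t + c t * a t)) = 1

theorem Sys.rot {γ : ℝ} {Q s1 s2 s3 a b c O : ℝ → ℝ} (h : Sys γ Q s1 s2 s3 a b c O) :
    Sys γ Q s2 s3 s1 b c a O where
  da := h.db
  db := h.dc
  dc := h.da
  ds1 := h.ds2
  ds2 := h.ds3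
  ds3 := h.ds1
  dO := h.dO
  hQ := fun t ht => by rw [h.hQ t ht]; ring
  hO := h.hO
  ha := h.hb
  hb := h.hc
  hc := h.ha
  hs := fun t ht => by rw [← h.hs t ht]; ring
  hcon := fun t ht => by rw [← h.hcon t ht]; ring

/-- The smallness condition up to time `T`. -/
def Bd (η T : ℝ) (a b c O : ℝ → ℝ) : Prop :=
  ∀ t ∈ Icc 0 T, O t ≤ η ∧ a t * b t ≤ η ∧ b t * c t ≤ η ∧ c t * a t ≤ η

theorem Bd.rot {η T : ℝ} {a b c O : ℝ → ℝ} (h : Bd η T a b c O) : Bd η T b c a O :=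
  fun t ht => ⟨(h t ht).1, (h t ht).2.2.1, (h t ht).2.2.2, (h t ht).2.1⟩

/-- Differential inequality helper. -/
theorem anti_of_deriv {f f' : ℝ → ℝ} {s T : ℝ} (hsT : s ≤ T)
    (hf : ∀ t ∈ Icc s T, HasDerivAt f (f' t) t) (hn : ∀ t ∈ Icc s T, f' t ≤ 0) :
    f T ≤ f s := by
  have : AntitoneOn f (Icc s T) := by
    apply antitoneOn_of_deriv_nonpos (convex_Icc s T)
    · exact fun t ht => (hf t ht).continuousAt.continuousWithinAt
    · exact fun t ht => (hf t (interior_subset ht)).differentiableAt.differentiableWithinAt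
    · intro t ht
      rw [(hf t (interior_subset ht)).deriv]
      exact hn t (interior_subset ht)
  exact this (left_mem_Icc.2 hsT) (right_mem_Icc.2 hsT) hsT

theorem growth {F r G g : ℝ → ℝ} {s T : ℝ} (hsT : s ≤ T)
    (hF : ∀ t ∈ Icc s T, HasDerivAt F (r t * F t) t) (hF0 : ∀ t ∈ Icc s T, 0 ≤ F t)
    (hG : ∀ t ∈ Icc s T, HasDerivAt G (g t) t) (h : ∀ t ∈ Icc s T, r t ≤ g t) :
    F T ≤ F s * exp (G T - G s) := by
  have := anti_of_deriv (f := fun t => F t * exp (- G t))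
    (f' := fun t => (r t * F t) * exp (- G t) + F t * (exp (- G t) * (- g t))) hsT
    (fun t ht => (hF t ht).mul ((hG t ht).neg.exp))
    (fun t ht => by
      have h1 := hF0 t ht
      have h2 := h t ht
      have : (r t * F t) * exp (- G t) + F t * (exp (- G t) * (- g t))
        = -((g t - r t) * (F t * exp (- G t))) := by ring
      rw [this]
      have := mul_nonneg (sub_nonneg.2 h2) (mul_nonneg h1 (exp_pos (- G t)).le)
      linarith)
  have h3 := mul_le_mul_of_nonneg_right this (exp_pos (G T)).le
  rw [mul_assoc, mul_assoc, ← exp_add, ← exp_add] at h3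
  simp only [neg_add_cancel, exp_zero, mul_one] at h3
  rwa [show -G s + G T = G T - G s by ring] at h3

/-- Pointwise a priori bounds. -/
theorem ptwise {γ O s1 s2 s3 a b c : ℝ} (hγ1 : 2/3 < γ) (hγ2 : γ < 2)
    (hO0 : 0 ≤ O) (hO : O ≤ 1/100) (ha : 0 < a) (hb : 0 < b) (hc : 0 < c)
    (hab : a * b ≤ 1/100) (hbc : b * c ≤ 1/100) (hca : c * a ≤ 1/100)
    (hs : s1 + s2 + s3 = 0)
    (hcon : O + (2/3) * (s1^2 + s2^2 + s3^2)
      + (3/4) * (a^2 + b^2 + c^2 - 2 * (a * b + b * c + c * a)) = 1) :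
    a ≤ 6/5 ∧ b ≤ 6/5 ∧ c ≤ 6/5 ∧ |s1| ≤ 103/100 ∧
    0 ≤ (3/2) * (2 - γ) * O ∧ (3/2) * (2 - γ) * O ≤ 2 * O := by
  have e : s1^2 ≤ (2/3) * (s1^2 + s2^2 + s3^2) := by
    have : s1 = -s2 - s3 := by linarith
    subst this
    nlinarith [sq_nonneg (s2 - s3)]
  have := mul_pos ha hb
  have := mul_pos hb hc
  have := mul_pos hc ha
  have hsq : 0 ≤ s1^2 := sq_nonneg _
  refine ⟨?_, ?_, ?_, ?_, ?_, ?_⟩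
  · nlinarith
  · nlinarith
  · nlinarith
  · apply abs_le_of_sq_le_sq _ (by norm_num)
    nlinarith
  · have : 0 < 2 - γ := by linarith
    positivity
  · nlinarith

theorem cross {a b κ η : ℝ} (ha : 0 < a) (hb : 0 < b) (hb2 : b ≤ 6/5) (hκ : 0 < κ) (hκ1 : κ ≤ 1)
    (hab : a * b ≤ η) : a ^ κ * b^2 ≤ (36/25) * η ^ κ := by
  have h1 : b^2 = b ^ κ * b ^ (2 - κ) := by
    rw [← rpow_add hb]; simp
  rw [h1, ← mul_assoc, ← mul_rpow ha.le hb.le]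
  have h2 : (a * b) ^ κ ≤ η ^ κ := rpow_le_rpow (by positivity) hab hκ.le
  have h3 : b ^ (2 - κ) ≤ 36/25 := by
    calc b ^ (2 - κ) ≤ (6/5 : ℝ) ^ (2 - κ) := rpow_le_rpow hb.le hb2 (by linarith)
      _ ≤ (6/5 : ℝ) ^ (2:ℝ) := rpow_le_rpow_of_exponent_le (by norm_num) (by linarith)
      _ = 36/25 := by norm_num
  calc (a * b) ^ κ * b ^ (2 - κ) ≤ η ^ κ * (36/25) :=
        mul_le_mul h2 h3 (rpow_nonneg hb.le _) (rpow_nonneg (by nlinarith [mul_pos ha hb]) _)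
    _ = _ := by ring

theorem rpow_le' {a κ : ℝ} (ha : 0 < a) (ha2 : a ≤ 6/5) (hκ : 0 < κ) (hκ1 : κ ≤ 1) :
    a ^ κ ≤ 6/5 := by
  calc a ^ κ ≤ (6/5 : ℝ) ^ κ := rpow_le_rpow ha.le ha2 hκ.le
    _ ≤ (6/5 : ℝ) ^ (1:ℝ) := rpow_le_rpow_of_exponent_le (by norm_num) hκ1
    _ = 6/5 := by norm_num

theorem sqlog {a κ : ℝ} (ha : 0 < a) (hκ : 0 < κ) :
    a^2 * (1 - a ^ κ) ≤ κ / 4 := by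
  have h1 : 1 - a ^ κ ≤ -(κ * log a) := by
    rw [rpow_def_of_pos ha]
    have := add_one_le_exp (log a * κ)
    linarith
  have h2 : -log a ≤ 1 / a - 1 := by
    have := log_le_sub_one_of_pos (inv_pos.2 ha)
    rw [log_inv] at this
    simpa using this
  calc a^2 * (1 - a ^ κ) ≤ a^2 * (κ * (1/a - 1)) := by
        apply mul_le_mul_of_nonneg_left _ (sq_nonneg a)
        nlinarith
    _ = κ * (a * (1 - a)) := by field_simp
    _ ≤ κ * (1/4) := by
        apply mul_le_mul_of_nonneg_left _ hκ.le
        nlinarith [sq_nonneg (a - 1/2)]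
    _ = _ := by ring

theorem log_bound {s : ℝ} (hs : |s| ≤ 103/100) : |log (2 - s)| ≤ 6/5 := by
  have h := abs_le.1 hs
  have hpos : 0 < 2 - s := by linarith
  rw [abs_le]
  constructor
  · have := one_sub_inv_le_log_of_pos hpos
    have h2 : (2 - s)⁻¹ ≤ 2 := by
      rw [inv_le_comm₀ hpos (by norm_num)]; linarith
    linarith
  · have : (2 - s) ≤ exp (6/5) := by
      have h3 := quadratic_le_exp_of_nonneg (x := 6/5) (by norm_num)
      have h4 : (3.03:ℝ) ≤ exp (6/5) := by
        have e1 : exp (6/5:ℝ) = exp 1 * exp (1/5) := by rw [← exp_add]; norm_num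
        have e2 := exp_one_gt_d9
        have e3 := add_one_le_exp (1/5:ℝ)
        rw [e1]; nlinarith
      linarith
    calc log (2 - s) ≤ log (exp (6/5)) := log_le_log hpos this
      _ = 6/5 := log_exp _

/-- One summand of the averaging function. -/
theorem summand_le {γ Q s a b c O κ A : ℝ} 
    (hκ : 0 < κ) (ha : 0 < a) (hb : 0 < b) (hc : 0 < c)
    (hs : |s| ≤ 103/100) (hA0 : 0 < A) (hA : A ≤ 6/5)
    (hO1 : 0 ≤ (3/2) * (2 - γ) * O) (hO2 : (3/2) * (2 - γ) * O ≤ 2 * O) 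
    (hQ : Q = (3/2) * (a^2 + b^2 + c^2 - 2 * (a * b + b * c + c * a)) + (3/2) * (2 - γ) * O)
    (hQl : -(1/10) ≤ Q) (hQu : Q ≤ 9/4) :
    A * Q - 5 * (A * b^2) - 5 * (A * c^2) - 6 * O - 10 * κ ≤
      κ * (4 * s - 2 + Q) * A * log (2 - s) + A * (-(Q * s + 3 * Sc a b c) / (2 - s)) := by
  have h := abs_le.1 hs
  have hpos : 0 < 2 - s := by linarith
  have hO0 : 0 ≤ O := by linarith
  have hab := mul_pos ha hb
  have hbc := mul_pos hb hc
  have hca := mul_pos hc ha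
  have h1 : Q - 5 * (b^2 + c^2) - 5 * O ≤ -(Q * s + 3 * Sc a b c) / (2 - s) := by
    rw [le_div_iff₀ hpos]
    have key : -(9/2) * (b^2 + c^2) - 4 * O ≤ - 2 * Q - 3 * Sc a b c := by
      rw [hQ]; unfold Sc; nlinarith
    have : (9/2) * (b^2 + c^2) + 4 * O ≤ (5 * (b^2 + c^2) + 5 * O) * (2 - s) := by
      have : 0 ≤ b^2 + c^2 := by positivity
      nlinarith
    nlinarith
  have h2 : -(10 * κ) ≤ κ * (4 * s - 2 + Q) * A * log (2 - s) := by
    have e1 : |κ * (4 * s - 2 + Q) * A * log (2 - s)| ≤ κ * (65/10) * (6/5) * (6/5) := by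
      rw [abs_mul, abs_mul, abs_mul, abs_of_pos hκ, abs_of_pos hA0]
      have : |4 * s - 2 + Q| ≤ 65/10 := abs_le.2 ⟨by linarith, by linarith⟩
      have := log_bound hs
      gcongr
    have := (abs_le.1 e1).1
    nlinarith
  have h3 := mul_le_mul_of_nonneg_left h1 hA0.le
  nlinarith

theorem Qbounds {γ Q O s1 s2 s3 a b c : ℝ} 
    (hO : O ≤ 1/100) (ha : 0 < a) (hb : 0 < b) (hc : 0 < c)
    (hab : a * b ≤ 1/100) (hbc : b * c ≤ 1/100) (hca : c * a ≤ 1/100)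
    (hcon : O + (2/3) * (s1^2 + s2^2 + s3^2)
      + (3/4) * (a^2 + b^2 + c^2 - 2 * (a * b + b * c + c * a)) = 1)
    (hO1 : 0 ≤ (3/2) * (2 - γ) * O) (hO2 : (3/2) * (2 - γ) * O ≤ 2 * O) 
    (hQ : Q = (3/2) * (a^2 + b^2 + c^2 - 2 * (a * b + b * c + c * a)) + (3/2) * (2 - γ) * O) :
    -(1/10) ≤ Q ∧ Q ≤ 9/4 := by
  have hab' := mul_pos ha hb
  have hbc' := mul_pos hb hc
  have hca' := mul_pos hc ha
  constructor
  · nlinarith [sq_nonneg a, sq_nonneg b, sq_nonneg c]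
  · nlinarith [sq_nonneg s1, sq_nonneg s2, sq_nonneg s3]

theorem weight_le {γ Q O a b c A B C κ η : ℝ}
    (hQ : Q = (3/2) * (a^2 + b^2 + c^2 - 2 * (a * b + b * c + c * a)) + (3/2) * (2 - γ) * O)
    (o1 : 0 ≤ (3/2) * (2 - γ) * O) (o2 : (3/2) * (2 - γ) * O ≤ 2 * η)
    (m1 : 0 < a * b) (n1 : a * b ≤ η) (m2 : 0 < b * c) (n2 : b * c ≤ η)
    (m3 : 0 < c * a) (n3 : c * a ≤ η) (hA0 : 0 < A) (hB0 : 0 < B) (hC0 : 0 < C)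
    (hA : A ≤ 6/5) (hB : B ≤ 6/5) (hC : C ≤ 6/5)
    (l1 : a^2 * (1 - A) ≤ κ / 4) (l2 : b^2 * (1 - B) ≤ κ / 4) (l3 : c^2 * (1 - C) ≤ κ / 4)
    (hκ : 0 < κ) :
    (1 - (A + B + C)) * Q ≤ 30 * η + 2 * κ := by
  have hη : 0 < η := by linarith
  by_cases hsg : A + B + C ≤ 1
  · have hQu : Q ≤ (3/2) * (a^2 + b^2 + c^2) + 2 * η := by linarith
    have i1 : (1 - (A + B + C)) * Q ≤
        (1 - (A + B + C)) * ((3/2) * (a^2 + b^2 + c^2) + 2 * η) :=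
      mul_le_mul_of_nonneg_left hQu (by linarith)
    have i2 : (1 - (A + B + C)) * a^2 ≤ (1 - A) * a^2 :=
      mul_le_mul_of_nonneg_right (by linarith) (sq_nonneg _)
    have i3 : (1 - (A + B + C)) * b^2 ≤ (1 - B) * b^2 :=
      mul_le_mul_of_nonneg_right (by linarith) (sq_nonneg _)
    have i4 : (1 - (A + B + C)) * c^2 ≤ (1 - C) * c^2 :=
      mul_le_mul_of_nonneg_right (by linarith) (sq_nonneg _)
    have i5 : (1 - (A + B + C)) * η ≤ 1 * η :=
      mul_le_mul_of_nonneg_right (by linarith) hη.le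
    linarith
  · have hQl : -(9 * η) ≤ Q := by
      linarith [sq_nonneg a, sq_nonneg b, sq_nonneg c]
    have j1 : (A + B + C - 1) * (-Q) ≤ (A + B + C - 1) * (9 * η) :=
      mul_le_mul_of_nonneg_left (by linarith) (by linarith)
    have j2 : (A + B + C - 1) * η ≤ 3 * η :=
      mul_le_mul_of_nonneg_right (by linarith) hη.le
    linarith

/-- Existence of a bounded averaging function. -/
theorem averaging {γ : ℝ} (hγ1 : 2/3 < γ) (hγ2 : γ < 2) {k : ℝ} (hk : 0 < k) (hk1 : k ≤ 1) :
    ∃ η > (0:ℝ), η ≤ 1/100 ∧ ∀ (Q s1 s2 s3 a b c O : ℝ → ℝ) (T : ℝ),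
      Sys γ Q s1 s2 s3 a b c O → Bd η T a b c O →
      ∃ h h' : ℝ → ℝ, (∀ t ∈ Icc 0 T, |h t| ≤ 5) ∧
        (∀ t ∈ Icc 0 T, HasDerivAt h (h' t) t) ∧ (∀ t ∈ Icc 0 T, Q t - k ≤ h' t) := by
  set κ := k / 100 with hκd
  have hκ : 0 < κ := by positivity
  have hκ1 : κ ≤ 1 := by linarith
  set η := min (k / 1000) ((k/200) ^ (1/κ)) with hη
  have hη0 : 0 < η := by positivity
  have hηk : η ≤ k/1000 := min_le_left _ _
  have hηκ : η ^ κ ≤ k / 200 := by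
    calc η ^ κ ≤ ((k/200) ^ (1/κ)) ^ κ := rpow_le_rpow hη0.le (min_le_right _ _) hκ.le
      _ = k / 200 := by
        rw [← rpow_mul (by positivity), one_div_mul_cancel hκ.ne', rpow_one]
  have hη100 : η ≤ 1/100 := by linarith
  refine ⟨η, hη0, hη100, ?_⟩
  intro Q s1 s2 s3 a b c O T hS hB
  refine ⟨fun t => (a t) ^ κ * log (2 - s1 t) + (b t) ^ κ * log (2 - s2 t)
      + (c t) ^ κ * log (2 - s3 t),
    fun t => (κ * (4 * s1 t - 2 + Q t) * (a t) ^ κ * log (2 - s1 t)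
        + (a t) ^ κ * (-(Q t * s1 t + 3 * Sc (a t) (b t) (c t)) / (2 - s1 t)))
      + (κ * (4 * s2 t - 2 + Q t) * (b t) ^ κ * log (2 - s2 t)
        + (b t) ^ κ * (-(Q t * s2 t + 3 * Sc (b t) (c t) (a t)) / (2 - s2 t)))
      + (κ * (4 * s3 t - 2 + Q t) * (c t) ^ κ * log (2 - s3 t)
        + (c t) ^ κ * (-(Q t * s3 t + 3 * Sc (c t) (a t) (b t)) / (2 - s3 t))), ?_, ?_, ?_⟩
  all_goals
    intro t ht
    have ht0 : 0 ≤ t := ht.1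
    obtain ⟨hO, hab, hbc, hca⟩ := hB t ht
    have pa := hS.ha t ht0
    have pb := hS.hb t ht0
    have pc := hS.hc t ht0
    have hO0 := hS.hO t ht0
    have hcon := hS.hcon t ht0
    have hs := hS.hs t ht0
    obtain ⟨a1, b1, c1, S1, o1, o2⟩ := ptwise hγ1 hγ2 hO0 (hO.trans hη100) pa pb pc
      (hab.trans hη100) (hbc.trans hη100) (hca.trans hη100) hs hcon
    obtain ⟨-, -, -, S2, -, -⟩ := ptwise hγ1 hγ2 hO0 (hO.trans hη100) pb pc pa
      (hbc.trans hη100) (hca.trans hη100) (hab.trans hη100) (hS.rot.hs t ht0) (hS.rot.hcon t ht0)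
    obtain ⟨-, -, -, S3, -, -⟩ := ptwise hγ1 hγ2 hO0 (hO.trans hη100) pc pa pb
      (hca.trans hη100) (hab.trans hη100) (hbc.trans hη100)
      (hS.rot.rot.hs t ht0) (hS.rot.rot.hcon t ht0)
    have hA := rpow_le' pa a1 hκ hκ1
    have hB' := rpow_le' pb b1 hκ hκ1
    have hC := rpow_le' pc c1 hκ hκ1
    have hA0 : 0 < (a t) ^ κ := rpow_pos_of_pos pa _
    have hB0 : 0 < (b t) ^ κ := rpow_pos_of_pos pb _
    have hC0 : 0 < (c t) ^ κ := rpow_pos_of_pos pc _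
  · have aux : ∀ A l : ℝ, 0 < A → A ≤ 6/5 → |l| ≤ 6/5 → |A * l| ≤ 36/25 := by
      intro A l h1 h2 h3
      rw [abs_mul, abs_of_pos h1]
      calc A * |l| ≤ (6/5) * (6/5) := by gcongr
        _ = 36/25 := by norm_num
    have e1 := abs_le.1 (aux _ _ hA0 hA (log_bound S1))
    have e2 := abs_le.1 (aux _ _ hB0 hB' (log_bound S2))
    have e3 := abs_le.1 (aux _ _ hC0 hC (log_bound S3))
    exact abs_le.2 ⟨by linarith, by linarith⟩
  · have aux : ∀ (x s : ℝ → ℝ) (x' s' : ℝ), 0 < x t → |s t| ≤ 103/100 →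
        HasDerivAt x (x' * x t) t → HasDerivAt s s' t →
        HasDerivAt (fun t => (x t) ^ κ * log (2 - s t))
          (κ * x' * (x t) ^ κ * log (2 - s t) + (x t) ^ κ * (-s' / (2 - s t))) t := by
      intro x s x' s' hx hst dx ds
      have hpos : (2 - s t) ≠ 0 := by
        have := abs_le.1 hst
        linarith
      have d1 := dx.rpow_const (p := κ) (Or.inl hx.ne')
      have d2 := (ds.const_sub 2).log hpos
      have d3 := d1.mul d2
      refine d3.congr_deriv ?_
      rw [rpow_sub_one hx.ne']
      field_simp
    exact ((aux a s1 _ _ pa S1 (hS.da t ht0) (hS.ds1 t ht0)).add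
      (aux b s2 _ _ pb S2 (hS.db t ht0) (hS.ds2 t ht0))).add
      (aux c s3 _ _ pc S3 (hS.dc t ht0) (hS.ds3 t ht0))
  · obtain ⟨q1, q2⟩ := Qbounds (hO.trans hη100) pa pb pc
      (hab.trans hη100) (hbc.trans hη100) (hca.trans hη100) hcon o1 o2 (hS.hQ t ht0)
    have f1 := summand_le hκ pa pb pc S1 hA0 hA o1 o2 (hS.hQ t ht0) q1 q2
    have f2 := summand_le hκ pb pc pa S2 hB0 hB' o1 o2 (hS.rot.hQ t ht0) q1 q2
    have f3 := summand_le hκ pc pa pb S3 hC0 hC o1 o2 (hS.rot.rot.hQ t ht0) q1 q2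
    have g1 := cross (η := η) pa pb b1 hκ hκ1 hab
    have g2 := cross (η := η) pa pc c1 hκ hκ1 (by rw [mul_comm]; exact hca)
    have g3 := cross (η := η) pb pc c1 hκ hκ1 hbc
    have g4 := cross (η := η) pb pa a1 hκ hκ1 (by rw [mul_comm]; exact hab)
    have g5 := cross (η := η) pc pa a1 hκ hκ1 hca
    have g6 := cross (η := η) pc pb b1 hκ hκ1 (by rw [mul_comm]; exact hbc)
    have l1 := sqlog pa hκ
    have l2 := sqlog pb hκ
    have l3 := sqlog pc hκ
    have main := weight_le (κ := κ) (hS.hQ t ht0) o1 (by linarith) (mul_pos pa pb) hab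
      (mul_pos pb pc) hbc (mul_pos pc pa) hca hA0 hB0 hC0 hA hB' hC l1 l2 l3 hκ
    linarith

theorem sq_le_four {T : ℝ} (h : |T| ≤ 2) : T^2 ≤ 4 := by
  rw [← sq_abs]; nlinarith [abs_nonneg T]

theorem g_bound {T : ℝ} (hT : |T| ≤ 2) : |T + T^3/24| ≤ 7/3 := by
  have : T + T^3/24 = T * (1 + T^2/24) := by ring
  rw [this, abs_mul]
  have hT2 := sq_le_four hT
  have : |1 + T^2/24| ≤ 7/6 := abs_le.2 ⟨by linarith [sq_nonneg T], by linarith⟩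
  calc |T| * |1 + T^2/24| ≤ 2 * (7/6) := by gcongr
    _ = 7/3 := by norm_num

theorem con_id {s1 s2 s3 : ℝ} (hs : s1 + s2 + s3 = 0) :
    (2/3) * (s1^2 + s2^2 + s3^2) = s1^2 + (s3-s2)^2/3 := by
  have e : s1 = -s2 - s3 := by linarith
  rw [e]; ring

theorem quad_form {k Y V : ℝ} (k0 : 0 ≤ k) (k1 : k ≤ 105/100) :
    -(1/12) * V^2 - (1/16) * Y^2 ≤ (1/8) * k * (Y * V) := by
  have t1 : -(Y^2 * (10/23) + V^2 * (23/40)) ≤ Y * V := by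
    nlinarith [sq_nonneg (Y * (20/23) + V)]
  have t2 : 0 ≤ (Y^2 * (10/23) + V^2 * (23/40)) := by positivity
  have t3 := mul_le_mul_of_nonneg_left t1 k0
  have t4 := mul_le_mul_of_nonneg_right k1 t2
  linarith [sq_nonneg Y, sq_nonneg V]

theorem near_pt {γ Q O s1 s2 s3 a b c w y m v T : ℝ}
    (hO0 : 0 ≤ O) (ha : 0 < a) (haw : a ≤ w) (hOw : O ≤ w) (ha1 : a ≤ 6/5)
    (hs : s1 + s2 + s3 = 0)
    (hcon : O + (2/3) * (s1^2 + s2^2 + s3^2)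
      + (3/4) * (a^2 + b^2 + c^2 - 2 * (a * b + b * c + c * a)) = 1)
    (o1 : 0 ≤ (3/2) * (2 - γ) * O) (o2 : (3/2) * (2 - γ) * O ≤ 2 * O) 
    (hQ : Q = (3/2) * (a^2 + b^2 + c^2 - 2 * (a * b + b * c + c * a)) + (3/2) * (2 - γ) * O)
    (hy : y = b - c) (hm : m = b + c) (hv : v = s3 - s2) (hm0 : 0 < m) (hm1 : m ≤ 9/10)
    (hv2 : |v| ≤ 21/10) (hT : |T| ≤ 2) (hyT : y = T * m / 2) :
    -4 * (1 + s1) + 2 * Q ≤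
      ((Q * v + (9/2) * y * (m - a)) * (T + T^3/24)
        + v * (-4 * v * (1 - T^2/4) * (1 + T^2/8))) / 6 + 30 * w := by
  have hw : 0 < w := ha.trans_le haw
  set R := Q - (3/2) * y^2 with hR
  have hQy : Q = (3/2) * y^2 + R := by rw [hR]; ring
  have hQ2 : Q = (3/2) * (y^2 + a^2 - 2 * (a * m)) + (3/2) * (2 - γ) * O := by
    rw [hQ, hy, hm]; ring
  have ham : 0 < a * m := mul_pos ha hm0
  have ham2 : a * m ≤ w := by nlinarith
  have haa : a^2 ≤ (6/5) * w := by nlinarith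
  have haa0 : 0 < a^2 := by positivity
  have hRw : |R| ≤ 5 * w := abs_le.2 ⟨by linarith, by linarith⟩
  have hT' := abs_le.1 hT
  have hg := g_bound hT
  have hT2 := sq_le_four hT
  -- the constraint
  have con2 : (1 + s1) * (1 - s1) = O + v^2/3 + (3/4) * y^2 + (3/4) * a^2 - (3/2) * (a * m) := by
    have e := con_id hs
    rw [hv, hy, hm]
    linarith
  have h1 : -4 * (1 + s1) + 2 * Q ≤ -(2/3) * v^2 + (3/2) * y^2 + 11 * w := by
    have : -4 * (1 + s1) ≤ - 2 * ((1 + s1) * (1 - s1)) := by nlinarith [sq_nonneg (1 + s1)]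
    rw [con2] at this
    linarith
  -- error terms
  have e1 : |R * v * (T + T^3/24)| ≤ 5 * w * (21/10) * (7/3) := by
    rw [abs_mul, abs_mul]; gcongr
  have hy1 : |y| ≤ 1 := by
    rw [hyT, abs_div, abs_mul, abs_of_pos hm0, abs_of_pos (by norm_num : (0:ℝ) < 2)]
    have : |T| * m ≤ 2 * (9/10) := by gcongr
    linarith
  have e2 : |y * a * (T + T^3/24)| ≤ 1 * w * (7/3) := by
    rw [abs_mul, abs_mul, abs_of_pos ha]; gcongr
  have e1' := (abs_le.1 e1).1
  have e2' := (abs_le.1 e2).2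
  -- main quadratic form
  have e3 : -(1/12) * (v * T)^2 - (1/16) * (y * T)^2 ≤
      (1/4) * y^2 * v * (T + T^3/24) := by
    have : (1/4) * y^2 * v * (T + T^3/24)
        = (1/8) * (m * (1 + T^2/24)) * ((y * T) * (v * T)) := by
      have : y^2 = y * (T * m / 2) := by rw [← hyT]; ring
      rw [this]; ring
    rw [this]
    have k0 : 0 ≤ m * (1 + T^2/24) := by positivity
    have k1 : m * (1 + T^2/24) ≤ 105/100 := by
      calc m * (1 + T^2/24) ≤ (9/10) * (1 + 4/24) := by gcongr
        _ = 105/100 := by norm_num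
    exact quad_form k0 k1
  have hym : y * m * (T + T^3/24) = 2 * y^2 * (1 + T^2/24) := by
    have : 2 * y^2 * (1 + T^2/24) = 2 * y * (T * m / 2) * (1 + T^2/24) := by rw [← hyT]; ring
    rw [this]; ring
  have hexp : ((Q * v + (9/2) * y * (m - a)) * (T + T^3/24)
        + v * (-4 * v * (1 - T^2/4) * (1 + T^2/8))) / 6
      = (1/4) * y^2 * v * (T + T^3/24) + (1/6) * (R * v * (T + T^3/24))
        + (3/4) * (y * m * (T + T^3/24)) - (3/4) * (y * a * (T + T^3/24))
        - (2/3) * v^2 + (1/12) * (v * T)^2 + (1/48) * (v * T^2)^2 := by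
    rw [hQy]; ring
  rw [hexp, hym]
  have : (3/4) * (2 * y^2 * (1 + T^2/24)) = (3/2) * y^2 + (1/16) * (y*T)^2 := by ring
  rw [this]
  linarith [sq_nonneg (v * T^2)]

theorem u_pt {γ Q O s1 s2 s3 a b c w : ℝ}
    (hO0 : 0 ≤ O) (ha : 0 < a) (haw : a ≤ w) (hOw : O ≤ w) (ha1 : a ≤ 6/5)
    (hb : 0 < b) (hc : 0 < c) (hb1 : b ≤ 6/5) (hc1 : c ≤ 6/5) (hS1 : |s1| ≤ 103/100)
    (hs : s1 + s2 + s3 = 0)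
    (hcon : O + (2/3) * (s1^2 + s2^2 + s3^2)
      + (3/4) * (a^2 + b^2 + c^2 - 2 * (a * b + b * c + c * a)) = 1)
    (o1 : 0 ≤ (3/2) * (2 - γ) * O) (o2 : (3/2) * (2 - γ) * O ≤ 2 * O) 
    (hQ : Q = (3/2) * (a^2 + b^2 + c^2 - 2 * (a * b + b * c + c * a)) + (3/2) * (2 - γ) * O)
    (hQu : Q ≤ 9/4) :
    -(30 * w) ≤ Q * s1 + 3 * Sc a b c := by
  have hw : 0 < w := ha.trans_le haw
  have hS := abs_le.1 hS1
  have hbc := mul_pos hb hc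
  have ham : 0 < a * (b + c) := by positivity
  have ham2 : a * (b + c) ≤ (12/5) * w := by nlinarith
  have haa : a^2 ≤ (6/5) * w := by nlinarith
  have id : Q * s1 + 3 * Sc a b c = Q * (1 + s1) - (9/2) * a^2 + (9/2) * (a * (b + c))
      - (3/2) * (2 - γ) * O := by
    unfold Sc
    have : Q * s1 = Q * (1 + s1) - Q := by ring
    rw [this]; nth_rewrite 2 [hQ]; ring
  rw [id]
  have hQl : -((72/10) * w) ≤ Q := by
    rw [hQ]; nlinarith [sq_nonneg (b - c), sq_nonneg a]
  have key : -(16 * w) ≤ Q * (1 + s1) := by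
    by_cases hu : 0 ≤ 1 + s1
    · have t1 := mul_le_mul_of_nonneg_right hQl hu
      have t2 : w * (1 + s1) ≤ w * (203/100) := mul_le_mul_of_nonneg_left (by linarith) hw.le
      linarith
    · push Not at hu
      have con2 : -((36/10) * w) ≤ (1 + s1) * (1 - s1) := by
        have e := con_id hs
        linarith [sq_nonneg (s3 - s2), sq_nonneg (b - c), sq_nonneg a]
      have hul : -((18/10) * w) ≤ 1 + s1 := by
        have : (1 + s1) * (1 - s1) ≤ (1 + s1) * 2 :=
          mul_le_mul_of_nonpos_left (by linarith) hu.le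
        linarith
      have : (9/4) * (1 + s1) ≤ Q * (1 + s1) := mul_le_mul_of_nonpos_right hQu hu.le
      linarith
  linarith

theorem T_bound {b c : ℝ} (pb : 0 < b) (pc : 0 < c) : |2 * (b - c) / (b + c)| ≤ 2 := by
  rw [abs_div, abs_of_pos (add_pos pb pc), div_le_iff₀ (add_pos pb pc), abs_le]
  constructor <;> linarith

theorem v_bound {O s1 s2 s3 a b c : ℝ}
    (hO0 : 0 ≤ O) (hab : a * b ≤ 1/100) (hbc : b * c ≤ 1/100) (hca : c * a ≤ 1/100)
    (hs : s1 + s2 + s3 = 0)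
    (hcon : O + (2/3) * (s1^2 + s2^2 + s3^2)
      + (3/4) * (a^2 + b^2 + c^2 - 2 * (a * b + b * c + c * a)) = 1) :
    |s3 - s2| ≤ 21/10 := by
  apply abs_le_of_sq_le_sq _ (by norm_num)
  have e := con_id hs
  linarith [sq_nonneg s1, sq_nonneg a, sq_nonneg b, sq_nonneg c]

theorem m_bound {O s1 s2 s3 a b c : ℝ}
    (hO0 : 0 ≤ O) (ha : 0 < a) (hb : 0 < b) (hc : 0 < c) (hbc : b * c ≤ 1/100)
    (ha1 : a ≤ 1/100) (hb1 : b ≤ 6/5) (hc1 : c ≤ 6/5)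
    (hS : |s1| ≤ 103/100) (hnear : s1 ≤ -(89/100))
    (hs : s1 + s2 + s3 = 0)
    (hcon : O + (2/3) * (s1^2 + s2^2 + s3^2)
      + (3/4) * (a^2 + b^2 + c^2 - 2 * (a * b + b * c + c * a)) = 1) :
    b + c ≤ 9/10 := by
  have e := con_id hs
  apply le_of_sq_le_sq _ (by norm_num)
  have h1 : (89/100)^2 ≤ s1^2 := by nlinarith
  have h2 : a * (b + c) ≤ (1/100) * (12/5) := by
    apply mul_le_mul ha1 (by linarith) (by positivity) (by norm_num)
  linarith [sq_nonneg (s3 - s2), sq_nonneg a]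

theorem near_phase {γ : ℝ} (hγ1 : 2/3 < γ) (hγ2 : γ < 2) {η Tm : ℝ} (hη : η ≤ 1/100)
    {Q s1 s2 s3 a b c O : ℝ → ℝ} (hS : Sys γ Q s1 s2 s3 a b c O) (hB : Bd η Tm a b c O)
    {w0 cc s T : ℝ} (hcc : 0 < cc) (hw0 : 0 ≤ w0) (hw1 : w0 ≤ 1/100) (hwc : 30 * w0 / cc ≤ 1/100)
    (hs0 : 0 ≤ s) (hsT : s ≤ T) (hTm : T ≤ Tm)
    (hw : ∀ t ∈ Icc s T, a t ≤ w0 * exp (-cc * t) ∧ O t ≤ w0 * exp (-cc * t))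
    (hnear : ∀ t ∈ Icc s T, s1 t ≤ -(89/100)) :
    b T * c T ≤ b s * c s * exp 3 := by
  set θ : ℝ → ℝ := fun t => 2 * (b t - c t) / (b t + c t) with hθ
  set W : ℝ → ℝ := fun t => (s3 t - s2 t) * (θ t + (θ t)^3 / 24) / 6 with hW
  have hexp1 : ∀ t, 0 ≤ t → exp (-cc * t) ≤ 1 := fun t ht =>
    exp_le_one_iff.2 (by nlinarith)
  have bounds : ∀ t ∈ Icc s T, |W t| ≤ 1 := by
    intro t ht
    have ht0 : 0 ≤ t := hs0.trans ht.1
    obtain ⟨hO, hab, hbc, hca⟩ := hB t ⟨ht0, ht.2.trans hTm⟩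
    have hv := v_bound (hS.hO t ht0) (hab.trans hη) (hbc.trans hη) (hca.trans hη)
      (hS.hs t ht0) (hS.hcon t ht0)
    have hg := g_bound (T_bound (hS.hb t ht0) (hS.hc t ht0))
    change |(s3 t - s2 t) * (θ t + (θ t)^3 / 24) / 6| ≤ 1
    rw [abs_div, abs_mul, abs_of_pos (by norm_num : (0:ℝ) < 6)]
    have : |s3 t - s2 t| * |θ t + (θ t)^3 / 24| ≤ (21/10) * (7/3) := by gcongr
    linarith
  have g := growth (F := fun t => b t * c t) (r := fun t => -4 * (1 + s1 t) + 2 * Q t)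
    (G := fun t => W t - (30 * w0 / cc) * exp (-cc * t))
    (g := fun t => ((Q t * (s3 t - s2 t) + (9/2) * (b t - c t) * ((b t + c t) - a t))
        * (θ t + (θ t)^3/24)
        + (s3 t - s2 t) * (-4 * (s3 t - s2 t) * (1 - (θ t)^2/4) * (1 + (θ t)^2/8))) / 6
        + 30 * (w0 * exp (-cc * t))) hsT ?_ ?_ ?_ ?_
  · beta_reduce at g
    refine g.trans ?_
    have hp : 0 ≤ b s * c s := (mul_pos (hS.hb s hs0) (hS.hc s hs0)).le
    apply mul_le_mul_of_nonneg_left _ hp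
    apply exp_le_exp.2
    have b1 := abs_le.1 (bounds s ⟨le_rfl, hsT⟩)
    have b2 := abs_le.1 (bounds T ⟨hsT, le_rfl⟩)
    have h0 : 0 ≤ 30 * w0 / cc := by positivity
    have e1 : (30 * w0 / cc) * exp (-cc * s) ≤ (30 * w0 / cc) * 1 :=
      mul_le_mul_of_nonneg_left (hexp1 s hs0) h0
    have e2 : 0 ≤ (30 * w0 / cc) * exp (-cc * T) := by positivity
    linarith
  · intro t ht
    have ht0 : 0 ≤ t := hs0.trans ht.1
    refine ((hS.db t ht0).mul (hS.dc t ht0)).congr_deriv ?_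
    have : s1 t = - s2 t - s3 t := by linarith [hS.hs t ht0]
    rw [this]; ring
  · intro t ht
    have ht0 : 0 ≤ t := hs0.trans ht.1
    exact (mul_pos (hS.hb t ht0) (hS.hc t ht0)).le
  · intro t ht
    have ht0 : 0 ≤ t := hs0.trans ht.1
    have pm : b t + c t ≠ 0 := (add_pos (hS.hb t ht0) (hS.hc t ht0)).ne'
    have dθ : HasDerivAt θ (-4 * (s3 t - s2 t) * (1 - (θ t)^2/4)) t := by
      refine ((((hS.db t ht0).sub (hS.dc t ht0)).const_mul 2).div
        ((hS.db t ht0).add (hS.dc t ht0)) pm).congr_deriv ?_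
      simp only [hθ, Pi.sub_apply, Pi.add_apply]
      field_simp
      ring
    have dv := (hS.ds3 t ht0).sub (hS.ds2 t ht0)
    have dW := (dv.mul (dθ.add ((dθ.pow 3).div_const 24))).div_const 6
    have dE : HasDerivAt (fun t => (30 * w0 / cc) * exp (-cc * t))
        ((30 * w0 / cc) * (exp (-cc * t) * (-cc * 1))) t :=
      (((hasDerivAt_id t).const_mul (-cc)).exp).const_mul _
    refine (dW.sub dE).congr_deriv ?_
    simp only [Pi.sub_apply, Pi.add_apply, Pi.pow_apply, Sc]
    field_simp
    ring
  · intro t ht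
    have ht0 : 0 ≤ t := hs0.trans ht.1
    obtain ⟨hO, hab, hbc, hca⟩ := hB t ⟨ht0, ht.2.trans hTm⟩
    have pa := hS.ha t ht0
    have pb := hS.hb t ht0
    have pc := hS.hc t ht0
    have hO0 := hS.hO t ht0
    have hcon := hS.hcon t ht0
    have hs := hS.hs t ht0
    have hwt := hw t ht
    obtain ⟨a1, b1, c1, S1, o1, o2⟩ := ptwise hγ1 hγ2 hO0 (hO.trans hη) pa pb pc
      (hab.trans hη) (hbc.trans hη) (hca.trans hη) hs hcon
    have hwle : w0 * exp (-cc * t) ≤ 1/100 := by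
      calc w0 * exp (-cc * t) ≤ w0 * 1 := mul_le_mul_of_nonneg_left (hexp1 t ht0) hw0
        _ ≤ 1/100 := by linarith
    have hm := m_bound hO0 pa pb pc (hbc.trans hη) (hwt.1.trans hwle) b1 c1 S1 (hnear t ht) hs hcon
    have hv := v_bound hO0 (hab.trans hη) (hbc.trans hη) (hca.trans hη) hs hcon
    have pm := add_pos pb pc
    exact near_pt hO0 pa hwt.1 hwt.2 a1 hs hcon o1 o2 (hS.hQ t ht0) rfl rfl rfl pm hm hv
      (T_bound pb pc) (by simp only [hθ]; field_simp)

theorem excursion {γ : ℝ} (hγ1 : 2/3 < γ) (hγ2 : γ < 2) {η Tm k : ℝ} (hη : η ≤ 1/100)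
    {Q s1 s2 s3 a b c O : ℝ → ℝ} (hS : Sys γ Q s1 s2 s3 a b c O) (hB : Bd η Tm a b c O)
    {h h' : ℝ → ℝ} (hk : k ≤ 1/5) (h5 : ∀ t ∈ Icc 0 Tm, |h t| ≤ 5)
    (hd : ∀ t ∈ Icc 0 Tm, HasDerivAt h (h' t) t) (hQ : ∀ t ∈ Icc 0 Tm, Q t - k ≤ h' t)
    {w0 cc s : ℝ} (hcc : 0 < cc) (hw0 : 0 ≤ w0) (hw1 : w0 ≤ 1/100) (hwc : 30 * w0 / cc ≤ 1/100)
    (hs0 : 0 ≤ s) (hsT : s ≤ Tm)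
    (hw : ∀ t ∈ Icc s Tm, a t ≤ w0 * exp (-cc * t) ∧ O t ≤ w0 * exp (-cc * t)) :
    b Tm * c Tm ≤ b s * c s * exp 23 := by
  set U : ℝ → ℝ := fun t => s1 t - (30 * w0 / cc) * exp (-cc * t) with hU
  have hexp1 : ∀ t, 0 ≤ t → exp (-cc * t) ≤ 1 := fun t ht =>
    exp_le_one_iff.2 (by nlinarith)
  have h0 : 0 ≤ 30 * w0 / cc := by positivity
  have hcorr : ∀ t, 0 ≤ t → 0 ≤ (30 * w0 / cc) * exp (-cc * t) ∧
      (30 * w0 / cc) * exp (-cc * t) ≤ 1/100 := by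
    intro t ht
    refine ⟨by positivity, ?_⟩
    calc _ ≤ (30 * w0 / cc) * 1 := mul_le_mul_of_nonneg_left (hexp1 t ht) h0
      _ ≤ _ := by linarith
  have dU : ∀ t ∈ Icc s Tm, HasDerivAt U
      ((Q t * s1 t + 3 * Sc (a t) (b t) (c t)) + 30 * (w0 * exp (-cc * t))) t := by
    intro t ht
    have dE : HasDerivAt (fun t => (30 * w0 / cc) * exp (-cc * t))
        ((30 * w0 / cc) * (exp (-cc * t) * (-cc * 1))) t :=
      (((hasDerivAt_id t).const_mul (-cc)).exp).const_mul _
    refine ((hS.ds1 t (hs0.trans ht.1)).sub dE).congr_deriv ?_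
    field_simp
    ring
  have mono : ∀ p r, s ≤ p → p ≤ r → r ≤ Tm → U p ≤ U r := by
    intro p r hp hpr hr
    have sub : Icc p r ⊆ Icc s Tm := Icc_subset_Icc hp hr
    have := anti_of_deriv (f := fun t => - U t) hpr (fun t ht => (dU t (sub ht)).neg) (by
      intro t ht
      have ht0 : 0 ≤ t := hs0.trans (sub ht).1
      obtain ⟨hO, hab, hbc, hca⟩ := hB t ⟨ht0, (sub ht).2⟩
      have pa := hS.ha t ht0
      have pb := hS.hb t ht0
      have pc := hS.hc t ht0
      have hO0 := hS.hO t ht0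
      have hcon := hS.hcon t ht0
      have hs := hS.hs t ht0
      have hwt := hw t (sub ht)
      obtain ⟨a1, b1, c1, S1, o1, o2⟩ := ptwise hγ1 hγ2 hO0 (hO.trans hη) pa pb pc
        (hab.trans hη) (hbc.trans hη) (hca.trans hη) hs hcon
      obtain ⟨q1, q2⟩ := Qbounds (hO.trans hη) pa pb pc
        (hab.trans hη) (hbc.trans hη) (hca.trans hη) hcon o1 o2 (hS.hQ t ht0)
      have := u_pt hO0 pa hwt.1 hwt.2 a1 pb pc b1 c1 S1 hs hcon o1 o2 (hS.hQ t ht0) q2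
      linarith)
    linarith
  have near : ∀ r, s ≤ r → r ≤ Tm → U r ≤ -(9/10) → b r * c r ≤ b s * c s * exp 3 := by
    intro r hsr hr hUr
    apply near_phase hγ1 hγ2 hη hS hB hcc hw0 hw1 hwc hs0 hsr hr
    · exact fun t ht => hw t ⟨ht.1, ht.2.trans hr⟩
    · intro t ht
      have h1 := mono t r ht.1 ht.2 hr
      have h2 := (hcorr t (hs0.trans ht.1)).2
      simp only [hU] at h1 hUr
      linarith
  have far : ∀ r, s ≤ r → r ≤ Tm → -(9/10) ≤ U r → b Tm * c Tm ≤ b r * c r * exp 20 := by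
    intro r hsr hr hUr
    have sub : Icc r Tm ⊆ Icc 0 Tm := Icc_subset_Icc (hs0.trans hsr) le_rfl
    have g := growth (F := fun t => b t * c t) (r := fun t => -4 * (1 + s1 t) + 2 * Q t)
      (G := fun t => 2 * h t) (g := fun t => 2 * h' t) hr ?_ ?_ ?_ ?_
    · beta_reduce at g
      refine g.trans ?_
      have hp : 0 ≤ b r * c r :=
        (mul_pos (hS.hb r (hs0.trans hsr)) (hS.hc r (hs0.trans hsr))).le
      apply mul_le_mul_of_nonneg_left _ hp
      apply exp_le_exp.2
      have b1 := abs_le.1 (h5 r (sub ⟨le_rfl, hr⟩))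
      have b2 := abs_le.1 (h5 Tm (sub ⟨hr, le_rfl⟩))
      linarith
    · intro t ht
      have ht0 : 0 ≤ t := (sub ht).1
      refine ((hS.db t ht0).mul (hS.dc t ht0)).congr_deriv ?_
      have : s1 t = - s2 t - s3 t := by linarith [hS.hs t ht0]
      rw [this]; ring
    · intro t ht
      have ht0 : 0 ≤ t := (sub ht).1
      exact (mul_pos (hS.hb t ht0) (hS.hc t ht0)).le
    · exact fun t ht => (hd t (sub ht)).const_mul 2
    · intro t ht
      have h1 := mono r t hsr ht.1 ht.2
      have h2 := (hcorr t (sub ht).1).1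
      have h3 := hQ t (sub ht)
      simp only [hU] at h1 hUr
      linarith
  have pp : 0 < b s * c s := mul_pos (hS.hb s hs0) (hS.hc s hs0)
  by_cases c1 : U Tm ≤ -(9/10)
  · refine (near Tm hsT le_rfl c1).trans ?_
    gcongr; norm_num
  by_cases c2 : -(9/10) ≤ U s
  · refine (far s le_rfl hsT c2).trans ?_
    gcongr; norm_num
  push Not at c1 c2
  have hcont : ContinuousOn U (Icc s Tm) :=
    fun t ht => (dU t ht).continuousAt.continuousWithinAt
  obtain ⟨r, hr, hUr⟩ := intermediate_value_Icc hsT hcont ⟨c2.le, c1.le⟩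
  have n1 := near r hr.1 hr.2 hUr.le
  have n2 := far r hr.1 hr.2 hUr.ge
  calc b Tm * c Tm ≤ b r * c r * exp 20 := n2
    _ ≤ (b s * c s * exp 3) * exp 20 := by gcongr
    _ = b s * c s * exp 23 := by rw [mul_assoc, ← exp_add]; norm_num

/-- The last time at which a continuous function is at most `δ`. -/
theorem last_time {f : ℝ → ℝ} {T δ : ℝ} (hT : 0 ≤ T) (hf : ContinuousOn f (Icc 0 T))
    (h0 : f 0 ≤ δ) (h1 : δ < f T) :
    ∃ s ∈ Icc 0 T, f s = δ ∧ ∀ t ∈ Icc s T, δ ≤ f t := by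
  set S := Icc 0 T ∩ f ⁻¹' Iic δ with hSd
  have hclosed : IsClosed S := hf.preimage_isClosed_of_isClosed isClosed_Icc isClosed_Iic
  have hcomp : IsCompact S := isCompact_Icc.of_isClosed_subset hclosed inter_subset_left
  have hne : S.Nonempty := ⟨0, ⟨le_rfl, hT⟩, h0⟩
  obtain ⟨s, hs, hmax⟩ := hcomp.exists_isGreatest hne
  have hgt : ∀ t ∈ Icc s T, s < t → δ < f t := by
    intro t ht hst
    by_contra hcon
    push Not at hcon
    have := hmax ⟨⟨hs.1.1.trans ht.1, ht.2⟩, hcon⟩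
    linarith
  have hs2 : f s ≤ δ := hs.2
  have hsT : s ≤ T := hs.1.2
  have heq : f s = δ := by
    by_contra hne2
    have hlt : f s < δ := lt_of_le_of_ne hs2 hne2
    obtain ⟨r, hr, hfr⟩ := intermediate_value_Icc hsT
      (hf.mono (Icc_subset_Icc hs.1.1 le_rfl)) ⟨hs2, h1.le⟩
    have hrs : r ≠ s := by rintro rfl; exact hne2 hfr
    have := hgt r hr (lt_of_le_of_ne hr.1 hrs.symm)
    linarith
  refine ⟨s, hs.1, heq, fun t ht => ?_⟩
  rcases eq_or_lt_of_le ht.1 with h | h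
  · rw [← h, heq]
  · exact (hgt t ht h).le

theorem prod_le {a b c ρ : ℝ} (ha : 0 < a) (hb : 0 < b) (hc : 0 < c) (hρ : 0 < ρ)
    (hab : a * b ≤ ρ^2) (hbc : b * c ≤ ρ^2) (hca : c * a ≤ ρ^2) : a * b * c ≤ ρ^3 := by
  apply le_of_sq_le_sq _ (by positivity)
  have h1 : (a * b) * (b * c) ≤ ρ^2 * ρ^2 := by gcongr
  have h2 : (a * b) * (b * c) * (c * a) ≤ ρ^2 * ρ^2 * ρ^2 := by gcongr
  calc (a * b * c)^2 = (a * b) * (b * c) * (c * a) := by ring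
    _ ≤ ρ^2 * ρ^2 * ρ^2 := h2
    _ = (ρ^3)^2 := by ring

theorem O_decay {γ : ℝ} {T k cc ρ : ℝ}
    {Q s1 s2 s3 a b c O : ℝ → ℝ} (hS : Sys γ Q s1 s2 s3 a b c O)
    {h h' : ℝ → ℝ} (hk : k ≤ (6 - 3*γ)/4) (h5 : ∀ t ∈ Icc 0 T, |h t| ≤ 5)
    (hd : ∀ t ∈ Icc 0 T, HasDerivAt h (h' t) t) (hQ : ∀ t ∈ Icc 0 T, Q t - k ≤ h' t)
    (hcc : cc ≤ (6 - 3*γ)/2) (hO : O 0 ≤ ρ^2) :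
    ∀ t ∈ Icc 0 T, O t ≤ ρ^2 * exp 20 * exp (-cc * t) := by
  intro t ht
  have sub : Icc 0 t ⊆ Icc 0 T := Icc_subset_Icc le_rfl ht.2
  have g := growth (F := O) (r := fun t => -(6 - 3*γ) + 2 * Q t)
    (G := fun t => 2 * h t + (-cc) * t) (g := fun t => 2 * h' t + (-cc) * 1) ht.1
    (fun r hr => hS.dO r hr.1) (fun r hr => hS.hO r hr.1)
    (fun r hr => ((hd r (sub hr)).const_mul 2).add ((hasDerivAt_id r).const_mul (-cc)))
    (fun r hr => by
      have := hQ r (sub hr)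
      linarith)
  refine g.trans ?_
  rw [mul_assoc, ← exp_add]
  have b1 := abs_le.1 (h5 0 ⟨le_rfl, ht.1.trans ht.2⟩)
  have b2 := abs_le.1 (h5 t ht)
  apply mul_le_mul hO _ (exp_pos _).le (by positivity)
  apply exp_le_exp.2
  linarith

theorem P_decay {γ : ℝ} {T k cc ρ : ℝ} (hρ : 0 < ρ)
    {Q s1 s2 s3 a b c O : ℝ → ℝ} (hS : Sys γ Q s1 s2 s3 a b c O)
    {h h' : ℝ → ℝ} (hk : k ≤ 1/5) (h5 : ∀ t ∈ Icc 0 T, |h t| ≤ 5)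
    (hd : ∀ t ∈ Icc 0 T, HasDerivAt h (h' t) t) (hQ : ∀ t ∈ Icc 0 T, Q t - k ≤ h' t)
    (hcc : cc ≤ 3) (hab : a 0 * b 0 ≤ ρ^2) (hbc : b 0 * c 0 ≤ ρ^2) (hca : c 0 * a 0 ≤ ρ^2) :
    ∀ t ∈ Icc 0 T, a t * b t * c t ≤ ρ^3 * exp 30 * exp (-cc * t) := by
  intro t ht
  have sub : Icc 0 t ⊆ Icc 0 T := Icc_subset_Icc le_rfl ht.2
  have g := growth (F := fun t => a t * b t * c t) (r := fun t => -6 + 3 * Q t)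
    (G := fun t => 3 * h t + (-cc) * t) (g := fun t => 3 * h' t + (-cc) * 1) ht.1
    (fun r hr => by
      refine (((hS.da r hr.1).mul (hS.db r hr.1)).mul (hS.dc r hr.1)).congr_deriv ?_
      have : s1 r = - s2 r - s3 r := by linarith [hS.hs r hr.1]
      simp only [Pi.mul_apply]
      rw [this]; ring)
    (fun r hr => (mul_pos (mul_pos (hS.ha r hr.1) (hS.hb r hr.1)) (hS.hc r hr.1)).le)
    (fun r hr => ((hd r (sub hr)).const_mul 3).add ((hasDerivAt_id r).const_mul (-cc)))
    (fun r hr => by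
      have := hQ r (sub hr)
      linarith)
  refine g.trans ?_
  rw [mul_assoc (ρ^3), ← exp_add]
  have b1 := abs_le.1 (h5 0 ⟨le_rfl, ht.1.trans ht.2⟩)
  have b2 := abs_le.1 (h5 t ht)
  apply mul_le_mul (prod_le (hS.ha 0 le_rfl) (hS.hb 0 le_rfl) (hS.hc 0 le_rfl) hρ hab hbc hca)
    _ (exp_pos _).le (by positivity)
  apply exp_le_exp.2
  linarith

theorem pair_lt {γ : ℝ} (hγ1 : 2/3 < γ) (hγ2 : γ < 2) {η T k cc ρ : ℝ} (hη : η ≤ 1/100)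
    {Q s1 s2 s3 a b c O : ℝ → ℝ} (hS : Sys γ Q s1 s2 s3 a b c O) (hB : Bd η T a b c O)
    {h h' : ℝ → ℝ} (hk : k ≤ 1/5) (hk2 : k ≤ (6 - 3*γ)/4) (h5 : ∀ t ∈ Icc 0 T, |h t| ≤ 5)
    (hd : ∀ t ∈ Icc 0 T, HasDerivAt h (h' t) t) (hQ : ∀ t ∈ Icc 0 T, Q t - k ≤ h' t)
    (hT : 0 ≤ T) (hcc0 : 0 < cc) (hcc : cc ≤ (6 - 3*γ)/2) (hcc3 : cc ≤ 3)
    (hρ : 0 < ρ) (hρ1 : ρ ≤ 1) (hρη : exp 30 * ρ < η) (hρc : 30 * (exp 30 * ρ) / cc ≤ 1/100)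
    (hO : O 0 ≤ ρ^2)
    (hab : a 0 * b 0 ≤ ρ^2) (hbc : b 0 * c 0 ≤ ρ^2) (hca : c 0 * a 0 ≤ ρ^2) :
    b T * c T < η := by
  have hsq : ρ^2 ≤ ρ := by nlinarith
  have hOd := O_decay hS hk2 h5 hd hQ hcc hO
  have hPd := P_decay hρ hS hk h5 hd hQ hcc3 hab hbc hca
  by_cases hlt : b T * c T ≤ ρ^2
  · have : (1:ℝ) ≤ exp 30 := one_le_exp (by norm_num)
    nlinarith
  push Not at hlt
  have hcont : ContinuousOn (fun t => b t * c t) (Icc 0 T) := fun t ht =>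
    ((hS.db t ht.1).mul (hS.dc t ht.1)).continuousAt.continuousWithinAt
  obtain ⟨s, hs, hs1, hs2⟩ := last_time hT hcont hbc hlt
  have ex := excursion hγ1 hγ2 hη hS hB hk h5 hd hQ (w0 := exp 30 * ρ) hcc0 (by positivity)
    (by linarith) hρc hs.1 hs.2 (by
      intro t ht
      have ht0 : t ∈ Icc 0 T := ⟨hs.1.trans ht.1, ht.2⟩
      constructor
      · have p := hPd t ht0
        have q := hs2 t ht
        have pa := hS.ha t ht0.1
        have : a t * ρ^2 ≤ (exp 30 * ρ * exp (-cc * t)) * ρ^2 := by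
          calc a t * ρ^2 ≤ a t * (b t * c t) := mul_le_mul_of_nonneg_left q pa.le
            _ = a t * b t * c t := by ring
            _ ≤ _ := p
            _ = _ := by ring
        exact le_of_mul_le_mul_right this (by positivity)
      · refine (hOd t ht0).trans ?_
        rw [mul_comm (exp 30)]
        gcongr
        norm_num)
  beta_reduce at hs1
  rw [hs1] at ex
  calc b T * c T ≤ ρ^2 * exp 23 := ex
    _ ≤ ρ * exp 30 := by gcongr; norm_num
    _ < η := by linarith

theorem first_time {f : ℝ → ℝ} {η : ℝ} (hf : ∀ t, 0 ≤ t → ContinuousAt f t) (h0 : f 0 < η)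
    (hstep : ∀ T, 0 ≤ T → (∀ t ∈ Icc 0 T, f t ≤ η) → f T < η) :
    ∀ t, 0 ≤ t → f t ≤ η := by
  intro T hT
  by_contra hcon
  push Not at hcon
  have hc : ContinuousOn f (Icc 0 T) := fun t ht => (hf t ht.1).continuousWithinAt
  set S := Icc 0 T ∩ f ⁻¹' Ici η with hSd
  have hclosed : IsClosed S := hc.preimage_isClosed_of_isClosed isClosed_Icc isClosed_Ici
  have hcomp : IsCompact S := isCompact_Icc.of_isClosed_subset hclosed inter_subset_left
  have hne : S.Nonempty := ⟨T, ⟨hT, le_rfl⟩, hcon.le⟩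
  obtain ⟨s, hs, hmin⟩ := hcomp.exists_isLeast hne
  have hlt : ∀ t ∈ Icc 0 s, t < s → f t < η := by
    intro t ht hts
    by_contra hcon2
    push Not at hcon2
    have := hmin ⟨⟨ht.1, ht.2.trans hs.1.2⟩, hcon2⟩
    linarith
  have hs2 : η ≤ f s := hs.2
  have hle : f s ≤ η := by
    obtain ⟨r, hr, hfr⟩ := intermediate_value_Icc hs.1.1
      (hc.mono (Icc_subset_Icc le_rfl hs.1.2)) ⟨h0.le, hs2⟩
    rcases eq_or_lt_of_le hr.2 with h | h
    · rw [← h, hfr]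
    · have := hlt r hr h
      linarith
  have := hstep s hs.1.1 (fun t ht => by
    rcases eq_or_lt_of_le ht.2 with h | h
    · rw [h]; exact hle
    · exact (hlt t ht h).le)
  linarith

theorem stability {γ : ℝ} (hγ1 : 2/3 < γ) (hγ2 : γ < 2) {η2 : ℝ} (hη2 : 0 < η2) :
    ∃ ρ > (0:ℝ), ∀ Q s1 s2 s3 a b c O : ℝ → ℝ, Sys γ Q s1 s2 s3 a b c O →
      O 0 ≤ ρ^2 → a 0 * b 0 ≤ ρ^2 → b 0 * c 0 ≤ ρ^2 → c 0 * a 0 ≤ ρ^2 →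
      ∀ t, 0 ≤ t → O t ≤ η2 ∧ a t * b t ≤ η2 ∧ b t * c t ≤ η2 ∧ c t * a t ≤ η2 := by
  have hβ : 0 < 6 - 3*γ := by linarith
  set k := min (1/5) ((6 - 3*γ)/4) with hkd
  have hk0 : 0 < k := by positivity
  have hk1 : k ≤ 1/5 := min_le_left _ _
  have hk2 : k ≤ (6 - 3*γ)/4 := min_le_right _ _
  obtain ⟨η1, hη1, hη100, hav⟩ := averaging hγ1 hγ2 hk0 (by linarith)
  set η := min η1 η2 with hηd
  have hη0 : 0 < η := lt_min hη1 hη2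
  have hηη1 : η ≤ η1 := min_le_left _ _
  have hηη2 : η ≤ η2 := min_le_right _ _
  set cc := min ((6 - 3*γ)/2) 3 with hccd
  have hcc0 : 0 < cc := by positivity
  have hcc1 : cc ≤ (6 - 3*γ)/2 := min_le_left _ _
  have hcc3 : cc ≤ 3 := min_le_right _ _
  set μ := min η cc with hμd
  have hμ0 : 0 < μ := lt_min hη0 hcc0
  have hμη : μ ≤ η := min_le_left _ _
  have hμc : μ ≤ cc := min_le_right _ _
  set ρ := exp (-30) * (μ / 10000) with hρd
  have hρ0 : 0 < ρ := by positivity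
  have hρe : exp 30 * ρ = μ / 10000 := by
    rw [hρd, ← mul_assoc, ← exp_add]; norm_num
  have he30 : (1:ℝ) ≤ exp 30 := one_le_exp (by norm_num)
  have hρ1 : ρ ≤ 1 := by nlinarith
  have hρη : exp 30 * ρ < η := by rw [hρe]; linarith
  have hρc : 30 * (exp 30 * ρ) / cc ≤ 1/100 := by
    rw [hρe, div_le_iff₀ hcc0]; linarith
  refine ⟨ρ, hρ0, ?_⟩
  intro Q s1 s2 s3 a b c O hS hO hab hbc hca
  set f : ℝ → ℝ := fun t => max (O t) (max (a t * b t) (max (b t * c t) (c t * a t))) with hf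
  have hρηsq : ρ^2 * exp 20 < η := by
    calc ρ^2 * exp 20 ≤ ρ * exp 30 := by
          gcongr
          · nlinarith
          · norm_num
      _ < η := by linarith
  have hρsq : ρ^2 < η := by
    have : (1:ℝ) ≤ exp 20 := one_le_exp (by norm_num)
    nlinarith [sq_nonneg ρ]
  have key : ∀ t, 0 ≤ t → f t ≤ η := by
    apply first_time
    · intro t ht
      have ca := (hS.da t ht).continuousAt
      have cb := (hS.db t ht).continuousAt
      have cc' := (hS.dc t ht).continuousAt
      have cO := (hS.dO t ht).continuousAt
      exact cO.max ((ca.mul cb).max ((cb.mul cc').max (cc'.mul ca)))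
    · simp only [hf, max_lt_iff]
      exact ⟨by linarith, by linarith, by linarith, by linarith⟩
    · intro T hT hall
      have hB : Bd η T a b c O := by
        intro t ht
        have := hall t ht
        simpa only [hf, max_le_iff] using this
      have hB1 : Bd η1 T a b c O := fun t ht => by
        obtain ⟨h1, h2, h3, h4⟩ := hB t ht
        exact ⟨h1.trans hηη1, h2.trans hηη1, h3.trans hηη1, h4.trans hηη1⟩
      obtain ⟨h, h', h5, hd, hQ⟩ := hav Q s1 s2 s3 a b c O T hS hB1
      have hη' : η ≤ 1/100 := hηη1.trans hη100
      have p1 := pair_lt hγ1 hγ2 hη' hS hB hk1 hk2 h5 hd hQ hT hcc0 hcc1 hcc3 hρ0 hρ1 hρη hρc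
        hO hab hbc hca
      have p2 := pair_lt hγ1 hγ2 hη' hS.rot hB.rot hk1 hk2 h5 hd hQ hT hcc0 hcc1 hcc3 hρ0 hρ1
        hρη hρc hO hbc hca hab
      have p3 := pair_lt hγ1 hγ2 hη' hS.rot.rot hB.rot.rot hk1 hk2 h5 hd hQ hT hcc0 hcc1 hcc3
        hρ0 hρ1 hρη hρc hO hca hab hbc
      have pO := O_decay hS hk2 h5 hd hQ hcc1 hO T ⟨hT, le_rfl⟩
      have pO' : O T < η := by
        have : exp (-cc * T) ≤ 1 := exp_le_one_iff.2 (by nlinarith)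
        have : ρ^2 * exp 20 * exp (-cc * T) ≤ ρ^2 * exp 20 * 1 := by gcongr
        linarith
      simp only [hf, max_lt_iff]
      exact ⟨pO', p3, p1, p2⟩
  intro t ht
  have := (key t ht).trans hηη2
  simpa only [hf, max_le_iff] using this

/-- Conversion of a solution to the time-reversed symmetric form. -/
theorem SolOn.toSys {γ : ℝ} {O Sp Sm n1 n2 n3 : ℝ → ℝ}
    (h : SolOn γ (Set.Iic 0) O Sp Sm n1 n2 n3)
    (hn : ∀ τ ∈ Set.Iic (0:ℝ), 0 < n1 τ ∧ 0 < n2 τ ∧ 0 < n3 τ) :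
    Sys γ (fun t => 2 - qf γ (O (-t)) (Sp (-t)) (Sm (-t))) (fun t => Sp (-t))
      (fun t => -(Sp (-t) + √3 * Sm (-t)) / 2) (fun t => -(Sp (-t) - √3 * Sm (-t)) / 2)
      (fun t => n1 (-t)) (fun t => n2 (-t)) (fun t => n3 (-t)) (fun t => O (-t)) := by
  have s3 : √3 * √3 = (3:ℝ) := mul_self_sqrt (by norm_num)
  have rev : ∀ {f : ℝ → ℝ} {f' t : ℝ}, HasDerivAt f f' (-t) →
      HasDerivAt (fun t => f (-t)) (-f') t := by
    intro f f' t hf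
    have := hf.scomp t (hasDerivAt_neg t)
    simpa [Function.comp_def] using this
  have mem : ∀ {t : ℝ}, 0 ≤ t → -t ∈ Set.Iic (0:ℝ) := fun ht => by simpa using ht
  have hcon := fun t (ht : 0 ≤ t) => h.hcon (-t) (mem ht)
  simp only [Constraint] at hcon
  constructor
  · intro t ht
    exact (rev (h.hn1 (-t) (mem ht))).congr_deriv (by ring)
  · intro t ht
    exact (rev (h.hn2 (-t) (mem ht))).congr_deriv (by ring)
  · intro t ht
    exact (rev (h.hn3 (-t) (mem ht))).congr_deriv (by ring)
  · intro t ht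
    exact (rev (h.hSp (-t) (mem ht))).congr_deriv (by simp only [SPf, Sc]; ring)
  · intro t ht
    refine (((rev (h.hSp (-t) (mem ht))).add
      ((rev (h.hSm (-t) (mem ht))).const_mul (√3))).neg.div_const 2).congr_deriv ?_
    simp only [SPf, SMf, Sc]
    linear_combination (-(3/4) * (n3 (-t) - n2 (-t)) * (n1 (-t) - n2 (-t) - n3 (-t))) * s3
  · intro t ht
    refine (((rev (h.hSp (-t) (mem ht))).sub
      ((rev (h.hSm (-t) (mem ht))).const_mul (√3))).neg.div_const 2).congr_deriv ?_
    simp only [SPf, SMf, Sc]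
    linear_combination ((3/4) * (n3 (-t) - n2 (-t)) * (n1 (-t) - n2 (-t) - n3 (-t))) * s3
  · intro t ht
    exact (rev (h.hO (-t) (mem ht))).congr_deriv (by ring)
  · intro t ht
    simp only [qf]
    linear_combination (-2) * hcon t ht
  · exact fun t ht => h.hOnn (-t) (mem ht)
  · exact fun t ht => (hn (-t) (mem ht)).1
  · exact fun t ht => (hn (-t) (mem ht)).2.1
  · exact fun t ht => (hn (-t) (mem ht)).2.2
  · intro t ht
    ring
  · intro t ht
    linear_combination hcon t ht + (1/3) * (Sm (-t))^2 * s3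

theorem coord_le (x y : EuclideanSpace ℝ (Fin 6)) (i : Fin 6) : |x i - y i| ≤ dist x y := by
  rw [EuclideanSpace.dist_eq]
  apply Real.le_sqrt_of_sq_le
  rw [← Real.dist_eq]
  exact Finset.single_le_sum (f := fun i => dist (x i) (y i) ^ 2)
    (fun j _ => sq_nonneg _) (Finset.mem_univ i)

theorem dist_le_of_coord (x y : EuclideanSpace ℝ (Fin 6)) {r : ℝ} (hr : 0 ≤ r)
    (h : ∀ i, |x i - y i| ≤ r) : dist x y ≤ 3 * r := by
  rw [EuclideanSpace.dist_eq]
  apply Real.sqrt_le_iff.2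
  refine ⟨by positivity, ?_⟩
  have : ∀ i, dist (x i) (y i) ^ 2 ≤ r^2 := fun i => by
    rw [Real.dist_eq]
    have := h i
    gcongr
  calc ∑ i, dist (x i) (y i) ^ 2 ≤ ∑ _i : Fin 6, r^2 := Finset.sum_le_sum (fun i _ => this i)
    _ = 6 * r^2 := by simp
    _ ≤ (3 * r)^2 := by nlinarith [sq_nonneg r]

theorem attractor_nonempty : attractor.Nonempty := by
  refine ⟨!₂[0, 1, 0, 0, 0, 0], ?_⟩
  simp [attractor, Constraint]

theorem rescale {p m n σ : ℝ} (hσ0 : 0 < σ) (hσ : σ ≤ 1/10)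
    (h : |p^2 + m^2 + (3/4) * n^2 - 1| ≤ 5 * σ^2) :
    ∃ p' m' n' : ℝ, p'^2 + m'^2 + (3/4) * n'^2 = 1 ∧
      |p - p'| ≤ σ ∧ |m - m'| ≤ σ ∧ |n - n'| ≤ σ := by
  have hh := abs_le.1 h
  have hσσ : σ^2 ≤ σ/10 := by nlinarith
  have hpos : 0 < p^2 + m^2 + (3/4) * n^2 := by linarith
  set R := √(p^2 + m^2 + (3/4) * n^2) with hR
  have hR0 : 0 < R := Real.sqrt_pos.2 hpos
  have hR2 : R^2 = p^2 + m^2 + (3/4) * n^2 := Real.sq_sqrt hpos.le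
  have hR1 : |R - 1| ≤ 5 * σ^2 := by
    have e : |R^2 - 1| = |R - 1| * (R + 1) := by
      rw [show R^2 - 1 = (R - 1) * (R + 1) by ring, abs_mul, abs_of_pos (by linarith : 0 < R + 1)]
    rw [← hR2, e] at h
    nlinarith [abs_nonneg (R - 1)]
  have aux : ∀ x : ℝ, x^2 ≤ (4/3) * R^2 → |x - x / R| ≤ σ := by
    intro x hx
    have hxR : |x| ≤ 2 * R := by
      apply abs_le_of_sq_le_sq _ (by positivity)
      nlinarith
    rw [show x - x / R = (x / R) * (R - 1) by field_simp, abs_mul, abs_div, abs_of_pos hR0]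
    have h1 : |x| / R ≤ 2 := by rw [div_le_iff₀ hR0]; exact hxR
    calc |x| / R * |R - 1| ≤ 2 * (5 * σ^2) := by gcongr
      _ ≤ σ := by linarith
  refine ⟨p / R, m / R, n / R, ?_, aux p ?_, aux m ?_, aux n ?_⟩
  · rw [div_pow, div_pow, div_pow]
    field_simp
    linarith
  · rw [hR2]; nlinarith [sq_nonneg p, sq_nonneg m, sq_nonneg n]
  · rw [hR2]; nlinarith [sq_nonneg p, sq_nonneg m, sq_nonneg n]
  · rw [hR2]; nlinarith [sq_nonneg p, sq_nonneg m, sq_nonneg n]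

theorem close_dom {O p m a b c σ : ℝ} (hσ0 : 0 < σ) (hσ : σ ≤ 1/10)
    (hO0 : 0 ≤ O) (hO : O ≤ σ^2) (ha : 0 < a) (hb : 0 < b) (hc : 0 < c)
    (hab : a * b ≤ σ^2) (hbc : b * c ≤ σ^2) (hca : c * a ≤ σ^2)
    (hba : b ≤ a) (hca' : c ≤ a)
    (hcon : O + p^2 + m^2 + (3/4) * (a^2 + b^2 + c^2 - 2 * (a * b + b * c + c * a)) = 1) :
    |b| ≤ σ ∧ |c| ≤ σ ∧ |O| ≤ σ ∧ ∃ p' m' a' : ℝ, p'^2 + m'^2 + (3/4) * a'^2 = 1 ∧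
      |p - p'| ≤ σ ∧ |m - m'| ≤ σ ∧ |a - a'| ≤ σ := by
  have hb2 : b^2 ≤ σ^2 := by nlinarith
  have hc2 : c^2 ≤ σ^2 := by nlinarith
  have h1 := mul_pos ha hb
  have h2 := mul_pos hb hc
  have h3 := mul_pos hc ha
  refine ⟨abs_le_of_sq_le_sq hb2 hσ0.le, abs_le_of_sq_le_sq hc2 hσ0.le, ?_, ?_⟩
  · rw [abs_of_nonneg hO0]; nlinarith
  · apply rescale hσ0 hσ
    rw [abs_le]
    constructor <;> nlinarith [sq_nonneg b, sq_nonneg c]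

theorem infDist_small {O p m a b c σ : ℝ} (hσ0 : 0 < σ) (hσ : σ ≤ 1/10)
    (hO0 : 0 ≤ O) (hO : O ≤ σ^2) (ha : 0 < a) (hb : 0 < b) (hc : 0 < c)
    (hab : a * b ≤ σ^2) (hbc : b * c ≤ σ^2) (hca : c * a ≤ σ^2)
    (hcon : O + p^2 + m^2 + (3/4) * (a^2 + b^2 + c^2 - 2 * (a * b + b * c + c * a)) = 1) :
    Metric.infDist (!₂[O, p, m, a, b, c] : EuclideanSpace ℝ (Fin 6)) attractor ≤ 3 * σ := by
  have fin : ∀ p' m' a' b' c' : ℝ, p'^2 + m'^2 + (3/4) * (a'^2 + b'^2 + c'^2) = 1 →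
      a' * b' = 0 → b' * c' = 0 → c' * a' = 0 → |O| ≤ σ → |p - p'| ≤ σ → |m - m'| ≤ σ →
      |a - a'| ≤ σ → |b - b'| ≤ σ → |c - c'| ≤ σ →
      Metric.infDist (!₂[O, p, m, a, b, c] : EuclideanSpace ℝ (Fin 6)) attractor ≤ 3 * σ := by
    intro p' m' a' b' c' h0 h1 h2 h3 k0 k1 k2 k3 k4 k5
    have hy : (!₂[0, p', m', a', b', c'] : EuclideanSpace ℝ (Fin 6)) ∈ attractor := by
      refine ⟨?_, ?_, ?_, ?_, ?_⟩
      · change (0:ℝ) + p'^2 + m'^2 + (3/4) * (a'^2 + b'^2 + c'^2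
          - 2*(a'*b' + b'*c' + c'*a')) = 1
        rw [h1, h2, h3]; linarith
      · rfl
      · exact h1
      · exact h2
      · exact h3
    refine (Metric.infDist_le_dist_of_mem hy).trans (dist_le_of_coord _ _ hσ0.le ?_)
    intro i
    fin_cases i
    · simpa using k0
    · exact k1
    · exact k2
    · exact k3
    · exact k4
    · exact k5
  rcases le_total b a with h1 | h1
  · rcases le_total c a with h2 | h2
    · obtain ⟨kb, kc, kO, p', m', a', e, k1, k2, k3⟩ :=
        close_dom (p := p) (m := m) hσ0 hσ hO0 hO ha hb hc hab hbc hca h1 h2 hcon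
      exact fin p' m' a' 0 0 (by linarith) (by ring) (by ring) (by ring) kO k1 k2 k3
        (by simpa using kb) (by simpa using kc)
    · obtain ⟨ka, kb, kO, p', m', c', e, k1, k2, k3⟩ :=
        close_dom (p := p) (m := m) hσ0 hσ hO0 hO hc ha hb hca hab hbc h2 (h1.trans h2) (by linarith)
      exact fin p' m' 0 0 c' (by linarith) (by ring) (by ring) (by ring) kO k1 k2
        (by simpa using ka) (by simpa using kb) k3
  · rcases le_total c b with h2 | h2
    · obtain ⟨kc, ka, kO, p', m', b', e, k1, k2, k3⟩ :=
        close_dom (p := p) (m := m) hσ0 hσ hO0 hO hb hc ha hbc hca hab h2 h1 (by linarith)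
      exact fin p' m' 0 b' 0 (by linarith) (by ring) (by ring) (by ring) kO k1 k2
        (by simpa using ka) k3 (by simpa using kc)
    · obtain ⟨ka, kb, kO, p', m', c', e, k1, k2, k3⟩ :=
        close_dom (p := p) (m := m) hσ0 hσ hO0 hO hc ha hb hca hab hbc (h1.trans h2) h2 (by linarith)
      exact fin p' m' 0 0 c' (by linarith) (by ring) (by ring) (by ring) kO k1 k2
        (by simpa using ka) (by simpa using kb) k3

theorem prod_small {x y x' y' e : ℝ} (he1 : e ≤ 1) (h : x' * y' = 0)
    (hx : |x - x'| ≤ e) (hy : |y - y'| ≤ e) (hx' : |x'| ≤ 6/5) (hy' : |y'| ≤ 6/5) :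
    x * y ≤ 4 * e := by
  have he0 : 0 ≤ e := (abs_nonneg _).trans hx
  have : x * y = (x - x') * y' + x' * (y - y') + (x - x') * (y - y') := by
    linear_combination h
  rw [this]
  have a1 : (x - x') * y' ≤ e * (6/5) :=
    (le_abs_self _).trans (by rw [abs_mul]; gcongr)
  have a2 : x' * (y - y') ≤ (6/5) * e :=
    (le_abs_self _).trans (by rw [abs_mul]; gcongr)
  have a3 : (x - x') * (y - y') ≤ e * e :=
    (le_abs_self _).trans (by rw [abs_mul]; gcongr)
  nlinarith

theorem small_of_infDist {O p m a b c δ : ℝ} (hδ0 : 0 < δ) (hδ : δ ≤ 1/2)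
    (h : Metric.infDist (!₂[O, p, m, a, b, c] : EuclideanSpace ℝ (Fin 6)) attractor ≤ δ) :
    O ≤ 8 * δ ∧ a * b ≤ 8 * δ ∧ b * c ≤ 8 * δ ∧ c * a ≤ 8 * δ := by
  obtain ⟨y, hy, hd⟩ := (Metric.infDist_lt_iff attractor_nonempty).1
    (lt_of_le_of_lt h (by linarith : δ < 2 * δ))
  have hc : ∀ i, |(!₂[O, p, m, a, b, c] : EuclideanSpace ℝ (Fin 6)) i - y i| ≤ 2 * δ :=
    fun i => (coord_le _ _ i).trans hd.le
  obtain ⟨hcon, h0, h1, h2, h3⟩ := hy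
  have k0 : |O - y 0| ≤ 2 * δ := hc 0
  have k3 : |a - y 3| ≤ 2 * δ := hc 3
  have k4 : |b - y 4| ≤ 2 * δ := hc 4
  have k5 : |c - y 5| ≤ 2 * δ := hc 5
  simp only [Constraint] at hcon
  have e : (y 1)^2 + (y 2)^2 + (3/4) * ((y 3)^2 + (y 4)^2 + (y 5)^2) = 1 := by
    rw [h0, h1, h2, h3] at hcon
    linarith
  have b3 : |y 3| ≤ 6/5 := by
    apply abs_le_of_sq_le_sq _ (by norm_num)
    nlinarith [sq_nonneg (y 1), sq_nonneg (y 2), sq_nonneg (y 4), sq_nonneg (y 5)]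
  have b4 : |y 4| ≤ 6/5 := by
    apply abs_le_of_sq_le_sq _ (by norm_num)
    nlinarith [sq_nonneg (y 1), sq_nonneg (y 2), sq_nonneg (y 3), sq_nonneg (y 5)]
  have b5 : |y 5| ≤ 6/5 := by
    apply abs_le_of_sq_le_sq _ (by norm_num)
    nlinarith [sq_nonneg (y 1), sq_nonneg (y 2), sq_nonneg (y 3), sq_nonneg (y 4)]
  have he1 : 2 * δ ≤ 1 := by linarith
  refine ⟨?_, ?_, ?_, ?_⟩
  · rw [h0] at k0
    have := (abs_le.1 k0).2
    linarith
  · linarith [prod_small he1 h1 k3 k4 b3 b4]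
  · linarith [prod_small he1 h2 k4 k5 b4 b5]
  · linarith [prod_small he1 h3 k5 k3 b5 b3]

/-- for `2/3 < γ < 2`, solutions starting close to the Bianchi attractor
`𝒜` stay close to it for all `τ ≤ 0`. -/
theorem attractor_past_stability
    (γ : ℝ) (hγ1 : 2/3 < γ) (hγ2 : γ < 2) :
    ∀ ε > (0:ℝ), ∃ δ > (0:ℝ), ∀ O Sp Sm n1 n2 n3 : ℝ → ℝ,
      SolOn γ (Set.Iic 0) O Sp Sm n1 n2 n3 →
      (∀ τ ∈ Set.Iic (0:ℝ), 0 < n1 τ ∧ 0 < n2 τ ∧ 0 < n3 τ) →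
      Metric.infDist (stateVec O Sp Sm n1 n2 n3 0) attractor ≤ δ →
      ∀ τ ≤ (0:ℝ), Metric.infDist (stateVec O Sp Sm n1 n2 n3 τ) attractor ≤ ε := by
  intro ε hε
  set σ := min (1/10) (ε/3) with hσd
  have hσ0 : 0 < σ := by positivity
  have hσ1 : σ ≤ 1/10 := min_le_left _ _
  have hσε : σ ≤ ε/3 := min_le_right _ _
  obtain ⟨ρ, hρ, hst⟩ := stability hγ1 hγ2 (η2 := σ^2) (by positivity)
  set δ := min (1/2) (ρ^2/8) with hδd
  have hδ0 : 0 < δ := by positivity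
  have hδ1 : δ ≤ 1/2 := min_le_left _ _
  have hδρ : δ ≤ ρ^2/8 := min_le_right _ _
  refine ⟨δ, hδ0, ?_⟩
  intro O Sp Sm n1 n2 n3 hsol hpos hdist τ hτ
  obtain ⟨i0, i1, i2, i3⟩ := small_of_infDist hδ0 hδ1 hdist
  have key := hst _ _ _ _ _ _ _ _ (hsol.toSys hpos)
    (by simp only [neg_zero]; linarith) (by simp only [neg_zero]; linarith)
    (by simp only [neg_zero]; linarith) (by simp only [neg_zero]; linarith)
    (-τ) (by linarith)
  simp only [neg_neg] at key
  obtain ⟨k0, k1, k2, k3⟩ := key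
  obtain ⟨p1, p2, p3⟩ := hpos τ hτ
  have := infDist_small hσ0 hσ1 (hsol.hOnn τ hτ) k0 p1 p2 p3 k1 k2 k3 (hsol.hcon τ hτ)
  exact this.trans (by linarith)

end WainwrightHsu
end
end
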